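/- The Banach space Π := B(α)/L(α) is nonzero; equivalently, L(α) is a proper closed subspace of B(α). -/

import Mathlib

open Filter Topology Classical

noncomputable section

namespace Paper

variable (p : ℕ) [Fact p.Prime]
variable (L : Type) [NontriviallyNormedField L] [NormedAlgebra ℚ_[p] L]

/-- The canonical embedding `ℚ_p → L`. -/
noncomputable def iotaL : ℚ_[p] → L := algebraMap ℚ_[p] L

/-- The binomial coefficient `binom(z, n) = z(z-1)⋯(z-n+1)/n!` of a `p`-adic
integer, computed in `ℚ_p`. -/
noncomputable def binomQ (z : ℤ_[p]) (n : ℕ) : ℚ_[p] :=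
  (∏ i ∈ Finset.range n, ((z : ℚ_[p]) - (i : ℚ_[p]))) / (n.factorial : ℚ_[p])

/-- The Mahler coefficients `a_n(f) = ∑_{i=0}^n (-1)^i binom(n,i) f(n-i)`. -/
noncomputable def mahlerCoeff (f : ℤ_[p] → L) (n : ℕ) : L :=
  ∑ i ∈ Finset.range (n + 1), (-1 : L) ^ i * (n.choose i : L) * f (((n - i : ℕ) : ℤ_[p]))

/-- `f : ℤ_p → L` is of class `C^r` : the scaled Mahler coefficients
`n^r a_n(f)` tend to `0`, and `f` is the sum of its Mahler expansion. -/
def IsCr (r : ℝ) (f : ℤ_[p] → L) : Prop :=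
  Tendsto (fun n : ℕ => (n : ℝ) ^ r * ‖mahlerCoeff p L f n‖) atTop (nhds 0) ∧
  ∀ z : ℤ_[p], HasSum (fun n : ℕ => mahlerCoeff p L f n * iotaL p L (binomQ p z n)) (f z)

/-- The norm `‖f‖_r = sup_n (n+1)^r ‖a_n(f)‖` on `C^r(ℤ_p, L)`. -/
noncomputable def crNorm (r : ℝ) (f : ℤ_[p] → L) : ℝ :=
  ⨆ n : ℕ, ((n : ℝ) + 1) ^ r * ‖mahlerCoeff p L f n‖

/-- A continuous (= bounded) linear functional on `C^r(ℤ_p, L)`, i.e. a tempered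
distribution of order `r`. -/
structure CrDual (r : ℝ) where
  toFun : (ℤ_[p] → L) → L
  map_add' : ∀ f g : ℤ_[p] → L, IsCr p L r f → IsCr p L r g →
    toFun (f + g) = toFun f + toFun g
  map_smul' : ∀ (c : L) (f : ℤ_[p] → L), IsCr p L r f → toFun (c • f) = c * toFun f
  bound' : ∃ C : ℝ, ∀ f : ℤ_[p] → L, IsCr p L r f → ‖toFun f‖ ≤ C * crNorm p L r f

/-- The function `z ↦ 1_{a + pⁿℤ_p}(z) (z - a)^j`. -/
noncomputable def indPoly (a : ℤ_[p]) (n : ℕ) (j : ℕ) : ℤ_[p] → L := fun z =>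
  if ‖z - a‖ ≤ (p : ℝ) ^ (-(n : ℤ)) then (iotaL p L ((z : ℚ_[p]) - (a : ℚ_[p]))) ^ j else 0

/-- The norm `‖μ‖_{r,d} = sup_{a, 0 ≤ j ≤ d, n} p^{n(j-r)} ‖∫_{a+pⁿℤ_p} (z-a)^j dμ‖`. -/
noncomputable def dualNormRD (r : ℝ) (d : ℕ) (μ : CrDual p L r) : ℝ :=
  ⨆ (a : ℤ_[p]) (j : Fin (d + 1)) (n : ℕ),
    (p : ℝ) ^ ((n : ℝ) * (((j : ℕ) : ℝ) - r)) * ‖μ.toFun (indPoly p L a n j)‖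

/-- `f : ℤ_p → L` is locally polynomial of local degree at most `d`. -/
def IsLocPoly (d : ℕ) (f : ℤ_[p] → L) : Prop :=
  ∃ n : ℕ, ∀ a : ℤ_[p], ∃ P : Polynomial L, P.natDegree ≤ d ∧
    ∀ z : ℤ_[p], ‖z - a‖ ≤ (p : ℝ) ^ (-(n : ℤ)) → f z = Polynomial.eval (iotaL p L (z : ℚ_[p])) P

/-- A linear functional on `Pol^d(ℤ_p, L)`. -/
structure PolDual (d : ℕ) where
  toFun : (ℤ_[p] → L) → L
  map_add' : ∀ f g : ℤ_[p] → L, IsLocPoly p L d f → IsLocPoly p L d g →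
    toFun (f + g) = toFun f + toFun g
  map_smul' : ∀ (c : L) (f : ℤ_[p] → L), IsLocPoly p L d f → toFun (c • f) = c * toFun f

/-- The valuation `val(x) = -log_p ‖x‖` on `L`, normalized by `val(p) = 1`. -/
noncomputable def valL (x : L) : ℝ := -Real.logb p ‖x‖

/-- `g : ℤ_p → L` is a class-`C^{val α}` extension of
`z ↦ (αp/β)^{val z} z^{k-2} f(1/z)` from `ℤ_p ∖ {0}` to `ℤ_p`. -/
def Ext2 (k : ℕ) (α β : L) (f : ℚ_[p] → L) (g : ℤ_[p] → L) : Prop :=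
  IsCr p L (valL p L α) g ∧ ∀ z : ℤ_[p], z ≠ 0 →
    g z = (α * (p : L) / β) ^ ((z : ℚ_[p]).valuation) *
      (iotaL p L (z : ℚ_[p])) ^ (k - 2) * f (((z : ℚ_[p]))⁻¹)

/-- Membership in the Banach space `B(α)`. -/
def MemB (k : ℕ) (α β : L) (f : ℚ_[p] → L) : Prop :=
  IsCr p L (valL p L α) (fun z : ℤ_[p] => f ((p : ℚ_[p]) * (z : ℚ_[p]))) ∧
  ∃ g : ℤ_[p] → L, Ext2 p L k α β f g

/-- The extension `f₂` of `z ↦ (αp/β)^{val z} z^{k-2} f(1/z)` to `ℤ_p`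
(it is unique when it exists). -/
noncomputable def ext2 (k : ℕ) (α β : L) (f : ℚ_[p] → L) : ℤ_[p] → L :=
  if h : ∃ g : ℤ_[p] → L, Ext2 p L k α β f g then h.choose else 0

/-- The norm `‖f‖ = max(‖f₁‖_{val α}, ‖f₂‖_{val α})` on `B(α)`. -/
noncomputable def bNorm (k : ℕ) (α β : L) (f : ℚ_[p] → L) : ℝ :=
  max (crNorm p L (valL p L α) (fun z : ℤ_[p] => f ((p : ℚ_[p]) * (z : ℚ_[p]))))
      (crNorm p L (valL p L α) (ext2 p L k α β f))

/-- Determinant of a 2×2 matrix. -/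
noncomputable def det2 (m : Matrix (Fin 2) (Fin 2) ℚ_[p]) : ℚ_[p] :=
  m 0 0 * m 1 1 - m 0 1 * m 1 0

/-- The action of `g = (a b; c d) ∈ GL₂(ℚ_p)` on `B(α)`:
`(g·f)(z) = α^{-val(ad-bc)} (αp/β)^{val(-cz+a)} (-cz+a)^{k-2} f((dz-b)/(-cz+a))`,
the value at the pole `-cz+a = 0` being the one prescribed by the extension `f₂`. -/
noncomputable def gAct (k : ℕ) (α β : L) (m : Matrix (Fin 2) (Fin 2) ℚ_[p])
    (f : ℚ_[p] → L) : ℚ_[p] → L := fun z =>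
  if -(m 1 0) * z + m 0 0 = 0 then
    α ^ (-(det2 p m).valuation) * (α * (p : L) / β) ^ ((det2 p m / m 1 0).valuation) *
      (iotaL p L (det2 p m / m 1 0)) ^ (k - 2) * ext2 p L k α β f 0
  else
    α ^ (-(det2 p m).valuation) * (α * (p : L) / β) ^ ((-(m 1 0) * z + m 0 0).valuation) *
      (iotaL p L (-(m 1 0) * z + m 0 0)) ^ (k - 2) *
      f ((m 1 1 * z - m 0 1) / (-(m 1 0) * z + m 0 0))

/-- The monomial function `z ↦ z^j` on `ℚ_p`. -/
noncomputable def monomialFun (j : ℕ) : ℚ_[p] → L := fun z => (iotaL p L z) ^ j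

/-- The function `z ↦ (αp/β)^{val(z-a)} (z-a)^{k-2-j}` (extended by `0` at `z = a`). -/
noncomputable def specFun (k : ℕ) (α β : L) (a : ℚ_[p]) (j : ℕ) : ℚ_[p] → L := fun z =>
  if z = a then 0 else
    (α * (p : L) / β) ^ ((z - a).valuation) * (iotaL p L (z - a)) ^ (k - 2 - j)

/-- The generators of `L(α)` : the functions `z^j` and
`(αp/β)^{val(z-a)}(z-a)^{k-2-j}` for `0 ≤ j < val(α)` and `a ∈ ℚ_p`. -/
def lGen (k : ℕ) (α β : L) : Set (ℚ_[p] → L) :=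
  {f | ∃ j : ℕ, (j : ℝ) < valL p L α ∧
    (f = monomialFun p L j ∨ ∃ a : ℚ_[p], f = specFun p L k α β a j)}

/-- Membership in `L(α)`, the closure in `B(α)` of the span of the special
functions. -/
def MemLalpha (k : ℕ) (α β : L) (f : ℚ_[p] → L) : Prop :=
  MemB p L k α β f ∧ ∀ ε : ℝ, 0 < ε →
    ∃ g ∈ Submodule.span L (lGen p L k α β), bNorm p L k α β (f - g) < ε

/-- The quotient (semi)norm on `Π(V) = B(α)/L(α)`. -/
noncomputable def qNorm (k : ℕ) (α β : L) (f : ℚ_[p] → L) : ℝ :=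
  sInf {x : ℝ | ∃ g : ℚ_[p] → L, MemLalpha p L k α β g ∧ x = bNorm p L k α β (f - g)}

/-- `h : ℚ_p → L` is locally constant. -/
def LocConst (h : ℚ_[p] → L) : Prop :=
  ∀ x : ℚ_[p], ∃ n : ℕ, ∀ y : ℚ_[p], ‖y - x‖ ≤ (p : ℝ) ^ (-(n : ℤ)) → h y = h x

/-- `h` belongs to the smooth induced representation: `h` is locally constant and
`z ↦ (αp/β)^{val z} h(1/z)` extends to a locally constant function on `ℚ_p`. -/
def IndCond (α β : L) (h : ℚ_[p] → L) : Prop :=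
  LocConst p L h ∧ ∃ h' : ℚ_[p] → L, LocConst p L h' ∧
    ∀ z : ℚ_[p], z ≠ 0 → h' z = (α * (p : L) / β) ^ z.valuation * h z⁻¹

/-- The generators `z ↦ P(z) h(z)` of the locally algebraic representation `π(α)`. -/
def piGen (k : ℕ) (α β : L) : Set (ℚ_[p] → L) :=
  {f | ∃ (P : Polynomial L) (h : ℚ_[p] → L), P.natDegree ≤ k - 2 ∧ IndCond p L α β h ∧
    f = fun z => Polynomial.eval (iotaL p L z) P * h z}

/-- The locally algebraic representation `π(α)`, as a subspace of functions
`ℚ_p → L`. -/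
noncomputable def piRep (k : ℕ) (α β : L) : Submodule L (ℚ_[p] → L) :=
  Submodule.span L (piGen p L k α β)

/-- The standing hypotheses on `(k, α, β)` coming from an absolutely irreducible,
`φ`-semisimple crystalline representation: `k ≥ 2`, `α ≠ β`,
`0 < val(β) ≤ val(α)` and `val(α) + val(β) = k - 1`. -/
def Hyps (k : ℕ) (α β : L) : Prop :=
  2 ≤ k ∧ α ≠ β ∧ 0 < valL p L α ∧ 0 < valL p L β ∧
    valL p L α + valL p L β = (k : ℝ) - 1 ∧ valL p L β ≤ valL p L α

/-- `Λ` is a `GL₂(ℚ_p)`-stable `𝒪_L`-lattice in `π(α)`: an `𝒪_L`-submodule of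
`π(α)` generating it over `L`, containing no `L`-line and stable by the action. -/
def IsLatticeStable (k : ℕ) (α β : L) (Λ : Set (ℚ_[p] → L)) : Prop :=
  (∀ f ∈ Λ, f ∈ piRep p L k α β) ∧ ((0 : ℚ_[p] → L) ∈ Λ) ∧
  (∀ f ∈ Λ, ∀ g ∈ Λ, f + g ∈ Λ) ∧
  (∀ c : L, ‖c‖ ≤ 1 → ∀ f ∈ Λ, c • f ∈ Λ) ∧
  (∀ f ∈ piRep p L k α β, ∃ c : L, c ≠ 0 ∧ c • f ∈ Λ) ∧
  (∀ f, f ∈ piRep p L k α β → f ≠ 0 → ¬ ∀ c : L, c • f ∈ Λ) ∧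
  (∀ m : Matrix (Fin 2) (Fin 2) ℚ_[p], det2 p m ≠ 0 → ∀ f ∈ Λ, gAct p L k α β m f ∈ Λ)

section

variable {p L} [IsUltrametricDist L]

open Polynomial

set_option linter.unusedSectionVars false

/-- Every coefficient of `w` has norm at most `c`. -/
def CoeffBound (c : ℝ) (w : L[X]) : Prop := ∀ i, ‖w.coeff i‖ ≤ c

namespace CoeffBound

lemma nonneg {c : ℝ} {w : L[X]} (h : CoeffBound c w) : 0 ≤ c := (norm_nonneg _).trans (h 0)

lemma mono {c d : ℝ} {w : L[X]} (h : CoeffBound c w) (hcd : c ≤ d) : CoeffBound d w :=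
  fun i => (h i).trans hcd

lemma zero {c : ℝ} (hc : 0 ≤ c) : CoeffBound c (0 : L[X]) := fun i => by simpa using hc

lemma add {c : ℝ} {v w : L[X]} (hv : CoeffBound c v) (hw : CoeffBound c w) :
    CoeffBound c (v + w) := fun i => by
  rw [coeff_add]
  exact (IsUltrametricDist.norm_add_le_max _ _).trans (max_le (hv i) (hw i))

lemma neg {c : ℝ} {w : L[X]} (hw : CoeffBound c w) : CoeffBound c (-w) := fun i => by
  rw [coeff_neg, norm_neg]; exact hw i

lemma sub {c : ℝ} {v w : L[X]} (hv : CoeffBound c v) (hw : CoeffBound c w) :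
    CoeffBound c (v - w) := sub_eq_add_neg v w ▸ hv.add hw.neg

lemma sum {ι : Type*} {c : ℝ} (hc : 0 ≤ c) (s : Finset ι) (f : ι → L[X])
    (h : ∀ i ∈ s, CoeffBound c (f i)) : CoeffBound c (∑ i ∈ s, f i) := by
  classical
  induction s using Finset.induction_on with
  | empty => simpa using zero hc
  | insert a s ha ih =>
    rw [Finset.sum_insert ha]
    exact (h a (by simp)).add (ih fun i hi => h i (by simp [hi]))

lemma mul {c d : ℝ} {v w : L[X]} (hv : CoeffBound c v) (hw : CoeffBound d w) :
    CoeffBound (c * d) (v * w) := fun i => by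
  rw [coeff_mul]
  refine IsUltrametricDist.norm_sum_le_of_forall_le_of_nonneg (mul_nonneg hv.nonneg hw.nonneg) ?_
  intro x _
  rw [norm_mul]
  exact mul_le_mul (hv _) (hw _) (norm_nonneg _) hv.nonneg

lemma const (x : L) : CoeffBound ‖x‖ (C x) := fun i => by
  rw [coeff_C]; split_ifs <;> simp

lemma C_mul {c : ℝ} {w : L[X]} (x : L) (hw : CoeffBound c w) :
    CoeffBound (‖x‖ * c) (C x * w) := (const x).mul hw

lemma one : CoeffBound 1 (1 : L[X]) := by
  simpa using const (1 : L)

lemma X_pow (n : ℕ) : CoeffBound 1 (X ^ n : L[X]) := fun i => by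
  rw [coeff_X_pow]; split_ifs <;> simp

lemma pow {c : ℝ} {w : L[X]} (hw : CoeffBound c w) (n : ℕ) : CoeffBound (c ^ n) (w ^ n) := by
  induction n with
  | zero => simpa using one
  | succ n ih => rw [pow_succ, pow_succ]; exact ih.mul hw

lemma mul_of_one_left {c : ℝ} {v w : L[X]} (hv : CoeffBound 1 v) (hw : CoeffBound c w) :
    CoeffBound c (v * w) := by simpa using hv.mul hw

lemma pow_of_one {w : L[X]} (hw : CoeffBound 1 w) (n : ℕ) : CoeffBound 1 (w ^ n) := by
  simpa using hw.pow n

lemma prod_of_one {ι : Type*} (s : Finset ι) (f : ι → L[X])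
    (h : ∀ i ∈ s, CoeffBound 1 (f i)) : CoeffBound 1 (∏ i ∈ s, f i) := by
  classical
  induction s using Finset.induction_on with
  | empty => simpa using one
  | insert a s ha ih =>
    rw [Finset.prod_insert ha]
    exact (h a (by simp)).mul_of_one_left (ih fun i hi => h i (by simp [hi]))

lemma X_pow_sub_one (n : ℕ) : CoeffBound 1 (X ^ n - 1 : L[X]) := (X_pow n).sub one

lemma eval {c : ℝ} {w : L[X]} (hw : CoeffBound c w) {x : L} (hx : ‖x‖ ≤ 1) :
    ‖w.eval x‖ ≤ c := by
  rw [eval_eq_sum_range]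
  refine IsUltrametricDist.norm_sum_le_of_forall_le_of_nonneg hw.nonneg ?_
  intro i _
  rw [norm_mul, norm_pow]
  exact (mul_le_of_le_one_right (norm_nonneg _) (pow_le_one₀ (norm_nonneg _) hx)).trans (hw i)

lemma comp {c : ℝ} {w v : L[X]} (hw : CoeffBound c w) (hv : CoeffBound 1 v) :
    CoeffBound c (w.comp v) := by
  rw [comp_eq_sum_left, sum_def]
  refine sum hw.nonneg _ _ fun i _ => ?_
  simpa using (const (w.coeff i)).mul (hv.pow_of_one i) |>.mono (by simpa using hw i)

lemma taylor_one {c : ℝ} {w : L[X]} (hw : CoeffBound c w) : CoeffBound c (taylor 1 w) := by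
  rw [taylor_apply]
  refine hw.comp ?_
  have h1 := X_pow (L := L) 1
  rw [pow_one] at h1
  exact h1.add (by simpa using one (L := L))

lemma expand {c : ℝ} {w : L[X]} (hw : CoeffBound c w) (q : ℕ) : CoeffBound c (expand L q w) := by
  rw [expand_eq_comp_X_pow]; exact hw.comp (X_pow q)

/-- Euclidean division by a monic polynomial with integral coefficients preserves bounds. -/
lemma exists_div_mod {P : L[X]} (hP : P.Monic) (hP1 : CoeffBound 1 P) {c : ℝ} :
    ∀ (n : ℕ) (w : L[X]), w.natDegree < n → CoeffBound c w →
      ∃ q r : L[X], r + P * q = w ∧ r.degree < P.degree ∧ CoeffBound c q ∧ CoeffBound c r := by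
  intro n
  induction n with
  | zero => intro w hw; omega
  | succ n ih =>
    intro w hwn hw
    by_cases hdeg : w.degree < P.degree
    · exact ⟨0, w, by simp, hdeg, zero hw.nonneg, hw⟩
    push Not at hdeg
    by_cases hP0 : P.natDegree = 0
    · have : P = 1 := hP.natDegree_eq_zero.mp hP0
      exact ⟨w, 0, by simp [this], by simp [this], hw, zero hw.nonneg⟩
    set t : L[X] := C w.leadingCoeff * X ^ (w.natDegree - P.natDegree) with ht
    have htb : CoeffBound c t := by
      simpa using (const w.leadingCoeff).mul (X_pow _) |>.mono (by simpa using hw w.natDegree)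
    have hw0 : w ≠ 0 := by
      rintro rfl
      rw [degree_zero, le_bot_iff, degree_eq_bot] at hdeg
      exact hP.ne_zero hdeg
    have hlt := div_wf_lemma ⟨hdeg, hw0⟩ hP
    rw [← ht] at hlt
    have hn : (w - P * t).natDegree < n := by
      by_cases h0 : w - P * t = 0
      · rw [h0, natDegree_zero]
        have := natDegree_le_natDegree hdeg
        omega
      · have := natDegree_lt_natDegree h0 hlt
        omega
    obtain ⟨q, r, h1, h2, h3, h4⟩ := ih _ hn (hw.sub (hP1.mul_of_one_left htb))
    exact ⟨q + t, r, by rw [mul_add, ← add_assoc, h1]; ring, h2, h3.add htb, h4⟩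

lemma modByMonic {P : L[X]} (hP : P.Monic) (hP1 : CoeffBound 1 P) {c : ℝ} {w : L[X]}
    (hw : CoeffBound c w) : CoeffBound c (w %ₘ P) := by
  obtain ⟨q, r, h1, h2, h3, h4⟩ := exists_div_mod hP hP1 _ w (Nat.lt_succ_self _) hw
  rwa [(div_modByMonic_unique q r hP ⟨h1, h2⟩).2]

lemma of_monic_mul {P : L[X]} (hP : P.Monic) (hP1 : CoeffBound 1 P) {c : ℝ} {q : L[X]}
    (hw : CoeffBound c (P * q)) : CoeffBound c q := by
  obtain ⟨q', r, h1, h2, h3, h4⟩ := exists_div_mod hP hP1 _ _ (Nat.lt_succ_self _) hw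
  have e1 := (div_modByMonic_unique q' r hP ⟨h1, h2⟩).1
  rw [mul_divByMonic_cancel_left _ hP] at e1
  rwa [e1]

end CoeffBound

lemma norm_natCast_p : ‖(p : L)‖ = (p : ℝ)⁻¹ := by
  have h : (p : L) = algebraMap ℚ_[p] L (p : ℚ_[p]) := by simp
  rw [h, norm_algebraMap', Padic.norm_p]

lemma norm_natCast_eq (p : ℕ) [Fact p.Prime] [NormedAlgebra ℚ_[p] L] (n : ℕ) :
    ‖(n : L)‖ = ‖(n : ℚ_[p])‖ := by
  rw [← norm_algebraMap' L (n : ℚ_[p]), map_natCast]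

lemma one_le_mul_norm_natCast (p : ℕ) [Fact p.Prime] [NormedAlgebra ℚ_[p] L] {n : ℕ}
    (hn : n ≠ 0) : 1 ≤ (n : ℝ) * ‖(n : L)‖ := by
  rw [norm_natCast_eq p, Padic.norm_eq_zpow_neg_valuation (by exact_mod_cast hn),
    zpow_neg, Padic.valuation_natCast, zpow_natCast]
  have hp : (0 : ℝ) < p := by exact_mod_cast (Fact.out : p.Prime).pos
  rw [← div_eq_mul_inv, le_div_iff₀ (by positivity), one_mul]
  exact_mod_cast Nat.le_of_dvd (Nat.pos_of_ne_zero hn) pow_padicValNat_dvd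

lemma norm_choose_prime_pow_le {e i : ℕ} (hi : i ≠ 0) :
    ‖((p ^ e).choose i : L)‖ ≤ i * ((p : ℝ)⁻¹) ^ e := by
  have h : (p ^ e).choose i * i = p ^ e * (p ^ e - 1).choose (i - 1) := by
    have hp : 0 < p ^ e := pow_pos (Fact.out : p.Prime).pos e
    have := Nat.add_one_mul_choose_eq (p ^ e - 1) (i - 1)
    rw [Nat.sub_add_cancel hp, Nat.sub_add_cancel (Nat.pos_of_ne_zero hi)] at this
    exact this.symm
  have h1 : ‖((p ^ e).choose i : L)‖ * ‖(i : L)‖ ≤ ((p : ℝ)⁻¹) ^ e := by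
    rw [← norm_mul, ← Nat.cast_mul, h, Nat.cast_mul, norm_mul, Nat.cast_pow, norm_pow,
      norm_natCast_p]
    exact mul_le_of_le_one_right (by positivity) (IsUltrametricDist.norm_natCast_le_one L _)
  have h2 := one_le_mul_norm_natCast p (L := L) hi
  nlinarith [norm_nonneg ((p ^ e).choose i : L), norm_nonneg (i : L),
    mul_le_mul_of_nonneg_left h2 (norm_nonneg ((p ^ e).choose i : L)),
    mul_le_mul_of_nonneg_left h1 (Nat.cast_nonneg (α := ℝ) i)]

variable (p L) in
/-- The polynomial `X ^ (p ^ e) - 1`. -/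
def Ypol (e : ℕ) : L[X] := X ^ (p ^ e) - 1

variable (p L) in
/-- The `p ^ (e + 1)`-st cyclotomic polynomial, in the form `∑_{i < p} X ^ (i p ^ e)`. -/
def Phi (e : ℕ) : L[X] := ∑ i ∈ Finset.range p, (X ^ (p ^ e)) ^ i

variable (p L) in
/-- The polynomial `(X ^ (p ^ n) - 1) / (X - 1)`. -/
def Epol (n : ℕ) : L[X] := ∏ e ∈ Finset.range n, Phi p L e

lemma Ypol_zero : Ypol p L 0 = X - 1 := by simp [Ypol]

lemma Ypol_succ (e : ℕ) : Ypol p L (e + 1) = Phi p L e * Ypol p L e := by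
  rw [Ypol, Ypol, Phi, geom_sum_mul, pow_succ, pow_mul]

lemma Ypol_dvd_succ (e : ℕ) : Ypol p L e ∣ Ypol p L (e + 1) := by
  rw [Ypol_succ]; exact dvd_mul_left _ _

lemma Ypol_dvd {d e : ℕ} (h : d ≤ e) : Ypol p L d ∣ Ypol p L e := by
  induction e, h using Nat.le_induction with
  | base => exact dvd_rfl
  | succ n _ ih => exact ih.trans (Ypol_dvd_succ n)

lemma Epol_mul (n : ℕ) : Epol p L n * (X - 1) = Ypol p L n := by
  induction n with
  | zero => simp [Epol, Ypol]
  | succ n ih =>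
    rw [Epol, Finset.prod_range_succ, mul_right_comm, ← Epol, ih, Ypol_succ, mul_comm]

lemma Ypol_monic (e : ℕ) : (Ypol p L e).Monic := by
  have := monic_X_pow_sub_C (1 : L) (pow_pos (Fact.out : p.Prime).pos e).ne'
  simpa [Ypol] using this

lemma Phi_monic (e : ℕ) : (Phi p L e).Monic :=
  Monic.of_mul_monic_left (Ypol_monic e) (by
    have := Ypol_monic (p := p) (L := L) (e + 1)
    rwa [Ypol_succ, mul_comm] at this)

lemma Epol_monic (n : ℕ) : (Epol p L n).Monic :=
  monic_prod_of_monic _ _ fun e _ => Phi_monic e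

lemma Ypol_bound (e : ℕ) : CoeffBound 1 (Ypol p L e) := CoeffBound.X_pow_sub_one _

lemma Phi_bound (e : ℕ) : CoeffBound 1 (Phi p L e) :=
  CoeffBound.sum zero_le_one _ _ fun i _ => (CoeffBound.X_pow _).pow_of_one i

lemma Epol_bound (n : ℕ) : CoeffBound 1 (Epol p L n) :=
  CoeffBound.prod_of_one _ _ fun e _ => Phi_bound e

lemma Phi_eval_one (e : ℕ) : (Phi p L e).eval 1 = p := by
  simp [Phi, eval_finsetSum]

lemma Epol_eval_one (n : ℕ) : (Epol p L n).eval 1 = (p : L) ^ n := by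
  simp [Epol, eval_prod, Phi_eval_one]

lemma Epol_dvd_Ypol (n : ℕ) : Epol p L n ∣ Ypol p L n := ⟨_, (Epol_mul n).symm⟩

lemma Phi_dvd_Epol {e n : ℕ} (h : e < n) : Phi p L e ∣ Epol p L n :=
  Finset.dvd_prod_of_mem _ (Finset.mem_range.mpr h)

lemma Phi_dvd_Ypol {e n : ℕ} (h : e < n) : Phi p L e ∣ Ypol p L n :=
  (Phi_dvd_Epol h).trans (Epol_dvd_Ypol n)

lemma expand_Ypol (d e : ℕ) : expand L (p ^ d) (Ypol p L e) = Ypol p L (e + d) := by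
  simp [Ypol, ← pow_mul, pow_add, mul_comm]

lemma expand_Phi (d e : ℕ) : expand L (p ^ d) (Phi p L e) = Phi p L (e + d) := by
  simp [Phi, ← pow_mul, pow_add, mul_comm, mul_left_comm]

lemma isCoprime_Phi_of_lt {d e : ℕ} (h : d < e) : IsCoprime (Phi p L d) (Phi p L e) := by
  have h1 : IsCoprime (Ypol p L e) (Phi p L e) := by
    have h2 : Ypol p L e ∣ Phi p L e - C (p : L) := by
      have : Phi p L e - C (p : L) = ∑ i ∈ Finset.range p, ((X ^ (p ^ e)) ^ i - 1) := by
        rw [Finset.sum_sub_distrib]; simp [Phi]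
      rw [this]
      exact Finset.dvd_sum fun i _ => sub_one_dvd_pow_sub_one _ _
    obtain ⟨q, hq⟩ := h2
    have hp : (p : L) ≠ 0 := by
      rw [← norm_ne_zero_iff, norm_natCast_p]
      exact inv_ne_zero (by exact_mod_cast (Fact.out : p.Prime).ne_zero)
    refine ⟨-(C (p : L)⁻¹ * q), C (p : L)⁻¹, ?_⟩
    have : C (p : L)⁻¹ * C (p : L) = 1 := by rw [← C_mul, inv_mul_cancel₀ hp, C_1]
    linear_combination this + C (p : L)⁻¹ * hq
  exact h1.of_isCoprime_of_dvd_left (Phi_dvd_Ypol h)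

lemma isCoprime_Phi {d e : ℕ} (h : d ≠ e) : IsCoprime (Phi p L d) (Phi p L e) := by
  rcases lt_or_gt_of_ne h with h | h
  · exact isCoprime_Phi_of_lt h
  · exact (isCoprime_Phi_of_lt h).symm

variable (p) in
/-- `w` is congruent modulo `(X ^ (p ^ e) - 1) ^ K` to a polynomial bounded by `c`. -/
def ModBound (K e : ℕ) (c : ℝ) (w : L[X]) : Prop :=
  ∃ R : L[X], CoeffBound c R ∧ Ypol p L e ^ K ∣ w - R

lemma CoeffBound.modBound {c : ℝ} {w : L[X]} (h : CoeffBound c w) (K e : ℕ) :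
    ModBound p K e c w := ⟨w, h, by simp⟩

namespace ModBound

variable {K e : ℕ} {c d : ℝ} {v w : L[X]}

lemma nonneg (h : ModBound p K e c w) : 0 ≤ c := by
  obtain ⟨R, hR, -⟩ := h; exact hR.nonneg

lemma mono (h : ModBound p K e c w) (hcd : c ≤ d) : ModBound p K e d w := by
  obtain ⟨R, hR, h⟩ := h; exact ⟨R, hR.mono hcd, h⟩

lemma congr (h : ModBound p K e c w) (hvw : Ypol p L e ^ K ∣ v - w) : ModBound p K e c v := by
  obtain ⟨R, hR, h⟩ := h; exact ⟨R, hR, by simpa using hvw.add h⟩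

lemma add (hv : ModBound p K e c v) (hw : ModBound p K e c w) : ModBound p K e c (v + w) := by
  obtain ⟨R, hR, h⟩ := hv
  obtain ⟨R', hR', h'⟩ := hw
  exact ⟨R + R', hR.add hR', by rw [add_sub_add_comm]; exact h.add h'⟩

lemma sum {ι : Type*} (hc : 0 ≤ c) (s : Finset ι) (f : ι → L[X])
    (h : ∀ i ∈ s, ModBound p K e c (f i)) : ModBound p K e c (∑ i ∈ s, f i) := by
  classical
  induction s using Finset.induction_on with
  | empty => simpa using (CoeffBound.zero hc).modBound K e
  | insert a s ha ih =>
    rw [Finset.sum_insert ha]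
    exact (h a (by simp)).add (ih fun i hi => h i (by simp [hi]))

lemma mul (hv : ModBound p K e c v) (hw : ModBound p K e d w) :
    ModBound p K e (c * d) (v * w) := by
  obtain ⟨R, hR, h⟩ := hv
  obtain ⟨R', hR', h'⟩ := hw
  refine ⟨R * R', hR.mul hR', ?_⟩
  have : v * w - R * R' = (v - R) * w + R * (w - R') := by ring
  rw [this]
  exact (h.mul_right _).add (h'.mul_left _)

lemma C_mul (x : L) (h : ModBound p K e c w) : ModBound p K e (‖x‖ * c) (C x * w) :=
  ((CoeffBound.const x).modBound K e).mul h

lemma pow (hv : ModBound p K e c v) (n : ℕ) : ModBound p K e (c ^ n) (v ^ n) := by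
  induction n with
  | zero => simpa using CoeffBound.one.modBound K e
  | succ n ih => rw [pow_succ, pow_succ]; exact ih.mul hv

lemma of_le {e' : ℕ} (h : ModBound p K e c w) (he : e' ≤ e) : ModBound p K e' c w := by
  obtain ⟨R, hR, h⟩ := h
  exact ⟨R, hR, (pow_dvd_pow_of_dvd (Ypol_dvd he) K).trans h⟩

lemma modByMonic (h : ModBound p K e c w) : CoeffBound c (w %ₘ Ypol p L e ^ K) := by
  obtain ⟨R, hR, h⟩ := h
  rw [modByMonic_eq_of_dvd_sub ((Ypol_monic e).pow K) h]
  exact CoeffBound.modByMonic ((Ypol_monic e).pow K) ((Ypol_bound e).pow_of_one K) hR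

lemma of_modByMonic (h : CoeffBound c (w %ₘ Ypol p L e ^ K)) : ModBound p K e c w := by
  refine ⟨_, h, w /ₘ Ypol p L e ^ K, ?_⟩
  rw [modByMonic_eq_sub_mul_div, sub_sub_cancel]

lemma eval_one (h : ModBound p K 0 c w) (hK : K ≠ 0) : ‖w.eval 1‖ ≤ c := by
  obtain ⟨R, hR, q, hq⟩ := h
  have : w.eval 1 = R.eval 1 := by
    have := congrArg (Polynomial.eval 1) hq
    simpa [Ypol_zero, hK, sub_eq_zero] using this
  rw [this]
  exact hR.eval (by simp)

end ModBound

variable (p) in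
/-- The compatibility between the two halves of a pair of polynomials, for the first `n`
levels. -/
def Sol (K : ℕ) (α β : L) (n : ℕ) (f g : L[X]) : Prop :=
  ∀ e < n, Phi p L e ^ K ∣ C (α ^ (e + 1)) * f - C (β ^ (e + 1)) * g

lemma relIndex_ne_zero_of_finite_cover {A : Type*} [AddCommGroup A] (H K : AddSubgroup A)
    (S : Set A) (hS : S.Finite) (h : ∀ x ∈ K, ∃ s ∈ S, x - s ∈ H) : H.relIndex K ≠ 0 := by
  rw [AddSubgroup.relIndex]
  have : Finite S := hS
  choose! t ht using h
  have hf : Finite (K ⧸ H.addSubgroupOf K) := by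
    let φ : K ⧸ H.addSubgroupOf K → S := fun q => ⟨t q.out, (ht _ q.out.2).1⟩
    refine Finite.of_injective φ fun q q' hq => ?_
    have h1 := (ht _ q.out.2).2
    have h2 := (ht _ q'.out.2).2
    have h3 : t q.out = t q'.out := congrArg Subtype.val hq
    rw [h3] at h1
    rw [← q.out_eq, ← q'.out_eq]
    refine QuotientAddGroup.eq.mpr ?_
    rw [AddSubgroup.mem_addSubgroupOf]
    have := H.sub_mem h2 h1
    simpa [sub_eq_add_neg, add_comm, add_left_comm] using this
  exact AddSubgroup.index_ne_zero_of_finite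

variable (L) in
/-- The closed ball of radius `max ρ 0` around the origin. -/
def closedBallSubgroup (ρ : ℝ) : AddSubgroup L where
  carrier := {x | ‖x‖ ≤ max ρ 0}
  zero_mem' := by simp
  add_mem' {x y} hx hy := (IsUltrametricDist.norm_add_le_max x y).trans (max_le hx hy)
  neg_mem' {x} hx := by simpa using hx

variable (L) in
/-- The open ball of positive radius `ρ` around the origin. -/
def openBallSubgroup (ρ : ℝ) (hρ : 0 < ρ) : AddSubgroup L where
  carrier := {x | ‖x‖ < ρ}
  zero_mem' := by simpa using hρ
  add_mem' {x y} hx hy := (IsUltrametricDist.norm_add_le_max x y).trans_lt (max_lt hx hy)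
  neg_mem' {x} hx := by simpa using hx

lemma mem_closedBallSubgroup {ρ : ℝ} (hρ : 0 ≤ ρ) {x : L} :
    x ∈ closedBallSubgroup L ρ ↔ ‖x‖ ≤ ρ := by
  change ‖x‖ ≤ max ρ 0 ↔ _
  rw [max_eq_left hρ]

lemma mem_openBallSubgroup {ρ : ℝ} (hρ : 0 < ρ) {x : L} :
    x ∈ openBallSubgroup L ρ hρ ↔ ‖x‖ < ρ := Iff.rfl

lemma exists_finite_cover (p : ℕ) [Fact p.Prime] [NormedAlgebra ℚ_[p] L]
    [FiniteDimensional ℚ_[p] L] {ρ : ℝ} (hρ : 0 < ρ) :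
    ∃ T : Set L, T.Finite ∧ ∀ x : L, ‖x‖ ≤ 1 → ∃ t ∈ T, ‖x - t‖ < ρ := by
  have : ProperSpace L := FiniteDimensional.proper ℚ_[p] L
  obtain ⟨T, -, hT, hcov⟩ := (isCompact_closedBall (0 : L) 1).finite_cover_balls hρ
  refine ⟨T, hT, fun x hx => ?_⟩
  have := hcov (mem_closedBall_zero_iff.mpr hx)
  simpa [dist_eq_norm] using this

lemma openBall_relIndex_ne_zero (p : ℕ) [Fact p.Prime] [NormedAlgebra ℚ_[p] L]
    [FiniteDimensional ℚ_[p] L] {ρ : ℝ} (hρ : 0 < ρ) :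
    (openBallSubgroup L ρ hρ).relIndex (closedBallSubgroup L 1) ≠ 0 := by
  obtain ⟨T, hT, h⟩ := exists_finite_cover (L := L) p hρ
  exact relIndex_ne_zero_of_finite_cover _ _ T hT fun x hx =>
    h x ((mem_closedBallSubgroup zero_le_one).mp hx)

lemma closedBall_relIndex_ne_zero (p : ℕ) [Fact p.Prime] [NormedAlgebra ℚ_[p] L]
    [FiniteDimensional ℚ_[p] L] {ρ : ℝ} (hρ : 0 < ρ) :
    (closedBallSubgroup L ρ).relIndex (closedBallSubgroup L 1) ≠ 0 := fun h =>
  openBall_relIndex_ne_zero p hρ (AddSubgroup.relIndex_eq_zero_of_le_left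
    (fun _ hx => (mem_closedBallSubgroup hρ.le).mpr hx.le) h)

lemma closedBall_relIndex_lt_openBall (p : ℕ) [Fact p.Prime] [NormedAlgebra ℚ_[p] L]
    [FiniteDimensional ℚ_[p] L] {x : L} (hx : 0 < ‖x‖) (hx1 : ‖x‖ ≤ 1) :
    (closedBallSubgroup L ‖x‖).relIndex (closedBallSubgroup L 1) <
      (openBallSubgroup L ‖x‖ hx).relIndex (closedBallSubgroup L 1) := by
  have h1 : openBallSubgroup L ‖x‖ hx ≤ closedBallSubgroup L ‖x‖ :=
    fun _ hy => (mem_closedBallSubgroup hx.le).mpr (le_of_lt hy)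
  have h2 : closedBallSubgroup L ‖x‖ ≤ closedBallSubgroup L 1 := fun _ hy =>
    (mem_closedBallSubgroup zero_le_one).mpr (((mem_closedBallSubgroup hx.le).mp hy).trans hx1)
  have h3 := AddSubgroup.relIndex_mul_relIndex _ _ _ h1 h2
  have h4 := openBall_relIndex_ne_zero (L := L) p hx
  rw [← h3] at h4 ⊢
  have h5 := left_ne_zero_of_mul h4
  have h6 := right_ne_zero_of_mul h4
  have h7 : (openBallSubgroup L ‖x‖ hx).relIndex (closedBallSubgroup L ‖x‖) ≠ 1 := by
    rw [Ne, AddSubgroup.relIndex_eq_one]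
    intro h
    exact lt_irrefl _ ((mem_openBallSubgroup hx).mp (h ((mem_closedBallSubgroup hx.le).mpr le_rfl)))
  have h8 : 2 ≤ (openBallSubgroup L ‖x‖ hx).relIndex (closedBallSubgroup L ‖x‖) := by omega
  nlinarith [Nat.pos_of_ne_zero h6]

lemma closedBall_relIndex_mul {x y : L} (hx0 : x ≠ 0) (hx1 : ‖x‖ ≤ 1) (hy1 : ‖y‖ ≤ 1) :
    (closedBallSubgroup L ‖x * y‖).relIndex (closedBallSubgroup L 1) =
      (closedBallSubgroup L ‖y‖).relIndex (closedBallSubgroup L 1) *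
      (closedBallSubgroup L ‖x‖).relIndex (closedBallSubgroup L 1) := by
  have hmap (z : ℝ) (hz : 0 ≤ z) : (closedBallSubgroup L z).map (AddMonoidHom.mulLeft x) =
      closedBallSubgroup L (‖x‖ * z) := by
    ext w
    rw [AddSubgroup.mem_map, mem_closedBallSubgroup (by positivity)]
    constructor
    · rintro ⟨v, hv, rfl⟩
      rw [AddMonoidHom.coe_mulLeft, norm_mul]
      exact mul_le_mul_of_nonneg_left ((mem_closedBallSubgroup hz).mp hv) (norm_nonneg _)
    · intro hw
      refine ⟨x⁻¹ * w, (mem_closedBallSubgroup hz).mpr ?_, by simp [hx0]⟩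
      rw [norm_mul, norm_inv, inv_mul_le_iff₀ (norm_pos_iff.mpr hx0)]
      exact hw
  have h1 := AddSubgroup.relIndex_map_map_of_injective (f := AddMonoidHom.mulLeft x)
    (closedBallSubgroup L ‖y‖) (closedBallSubgroup L 1) (mul_right_injective₀ hx0)
  rw [hmap _ (norm_nonneg _), hmap _ zero_le_one, mul_one] at h1
  rw [norm_mul, ← h1, AddSubgroup.relIndex_mul_relIndex]
  · intro w hw
    rw [mem_closedBallSubgroup (by positivity)] at hw ⊢
    exact hw.trans (mul_le_of_le_one_right (norm_nonneg _) hy1)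
  · intro w hw
    rw [mem_closedBallSubgroup (by positivity)] at hw ⊢
    exact hw.trans hx1

lemma closedBall_prod_relIndex {ρ σ : ℝ} (hρ : 0 < ρ) (hσ : 0 < σ) :
    ((openBallSubgroup L ρ hρ).comap (AddMonoidHom.fst L L) ⊓
      (openBallSubgroup L σ hσ).comap (AddMonoidHom.snd L L)).relIndex
        ((closedBallSubgroup L 1).prod (closedBallSubgroup L 1)) =
      (openBallSubgroup L ρ hρ).relIndex (closedBallSubgroup L 1) *
      (openBallSubgroup L σ hσ).relIndex (closedBallSubgroup L 1) := by
  rw [← AddSubgroup.relIndex_inf_mul_relIndex, AddSubgroup.relIndex_comap,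
    AddSubgroup.relIndex_comap]
  congr 2
  · ext x
    simp only [AddSubgroup.mem_map, AddSubgroup.mem_inf, AddSubgroup.mem_comap,
      AddSubgroup.mem_prod, Prod.exists, AddMonoidHom.coe_fst, AddMonoidHom.coe_snd]
    constructor
    · rintro ⟨a, b, ⟨-, h, -⟩, rfl⟩; exact h
    · intro h
      exact ⟨x, 0, ⟨zero_mem _, h, zero_mem _⟩, rfl⟩
  · ext x
    simp only [AddSubgroup.mem_map, AddSubgroup.mem_prod, Prod.exists, AddMonoidHom.coe_snd]
    constructor
    · rintro ⟨a, b, ⟨-, h⟩, rfl⟩; exact h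
    · intro h
      exact ⟨0, x, ⟨zero_mem _, h⟩, rfl⟩

lemma exists_partition_of_one (K : ℕ) {n : ℕ} (hn : n ≠ 0) :
    ∃ π : ℕ → L[X], ∑ e ∈ Finset.range n, π e = 1 ∧
      ∀ e < n, ∀ d < n, d ≠ e → Phi p L d ^ K ∣ π e := by
  classical
  have h : Pairwise (Function.onFun IsCoprime
      fun i : Finset.range n => Phi p L i ^ K) := fun i j hij =>
    (isCoprime_Phi fun h => hij (Subtype.ext h)).pow
  obtain ⟨μ, hμ⟩ := (exists_sum_eq_one_iff_pairwise_coprime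
    (s := fun i => Phi p L i ^ K) (t := Finset.range n) (by simpa using hn)).mpr h
  refine ⟨_, hμ, fun e _ d hd hde => Dvd.dvd.mul_left (Finset.dvd_prod_of_mem _ ?_) _⟩
  simp [hd, hde]

lemma Epol_pow_dvd (K n : ℕ) {w : L[X]} (h : ∀ e < n, Phi p L e ^ K ∣ w) :
    Epol p L n ^ K ∣ w := by
  rw [Epol, ← Finset.prod_pow]
  refine Finset.prod_dvd_of_coprime ?_ fun e he => h e (Finset.mem_range.mp he)
  intro i _ j _ hij
  exact (isCoprime_Phi hij).pow

lemma exists_interpolation (K : ℕ) {n : ℕ} (hn : n ≠ 0) (x : ℕ → L) :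
    ∃ u : L[X], ∀ e < n, Phi p L e ^ K ∣ u - C (x e) := by
  obtain ⟨π, hπ, hd⟩ := exists_partition_of_one (p := p) (L := L) K hn
  refine ⟨∑ d ∈ Finset.range n, C (x d) * π d, fun e he => ?_⟩
  have : ∑ d ∈ Finset.range n, C (x d) * π d - C (x e) =
      ∑ d ∈ Finset.range n, C (x d - x e) * π d := by
    conv_lhs => rw [← mul_one (C (x e)), ← hπ, Finset.mul_sum]
    rw [← Finset.sum_sub_distrib]
    exact Finset.sum_congr rfl fun d _ => by rw [C_sub]; ring
  rw [this]
  refine Finset.dvd_sum fun d hdn => ?_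
  by_cases hde : e = d
  · subst hde; simp
  · exact Dvd.dvd.mul_left (hd d (Finset.mem_range.mp hdn) e he hde) _

lemma exists_coeffBound (w : L[X]) : ∃ c : ℝ, 0 < c ∧ CoeffBound c w := by
  refine ⟨1 + ∑ i ∈ w.support, ‖w.coeff i‖, by positivity, fun i => ?_⟩
  by_cases hi : i ∈ w.support
  · have := Finset.single_le_sum (f := fun i => ‖w.coeff i‖) (fun _ _ => norm_nonneg _) hi
    linarith
  · rw [notMem_support_iff.mp hi, norm_zero]; positivity

variable (L) in
/-- The polynomials with integral coefficients. -/
def integralPolys : AddSubgroup L[X] where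
  carrier := {w | CoeffBound 1 w}
  zero_mem' := CoeffBound.zero zero_le_one
  add_mem' hx hy := hx.add hy
  neg_mem' hx := hx.neg

/-- Modulo a monic integral polynomial, the integral polynomials have finitely many classes
up to polynomials of small size. -/
lemma exists_finite_poly_cover (p : ℕ) [Fact p.Prime] [NormedAlgebra ℚ_[p] L]
    [FiniteDimensional ℚ_[p] L] (N : ℕ) {ρ : ℝ} (hρ : 0 < ρ) :
    ∃ S : Set L[X], S.Finite ∧ ∀ w : L[X], CoeffBound 1 w → w.natDegree < N →
      ∃ s ∈ S, CoeffBound ρ (w - s) := by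
  obtain ⟨T, hT, h⟩ := exists_finite_cover (L := L) p hρ
  let φ : (Fin N → L) → L[X] := fun t => ∑ i : Fin N, C (t i) * X ^ (i : ℕ)
  refine ⟨φ '' {t | ∀ i, t i ∈ T}, (Set.Finite.pi' fun _ => hT).image φ, fun w hw hN => ?_⟩
  choose t ht1 ht2 using fun i : ℕ => h (w.coeff i) (hw i)
  refine ⟨_, ⟨fun i => t i, fun i => ht1 i, rfl⟩, ?_⟩
  have : w - φ (fun i => t i) = ∑ i ∈ Finset.range N, C (w.coeff i - t i) * X ^ i := by
    conv_lhs => rw [as_sum_range_C_mul_X_pow' w hN, Finset.sum_range, ← Finset.sum_sub_distrib]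
    rw [Finset.sum_range]
    exact Finset.sum_congr rfl fun i _ => by rw [C_sub, sub_mul]
  rw [this]
  refine CoeffBound.sum hρ.le _ _ fun i _ => ?_
  simpa using ((CoeffBound.const (w.coeff i - t i)).mul (CoeffBound.X_pow i)).mono
    (by simpa using (ht2 i).le)

lemma relIndex_map_eq_of_finite {A : Type*} [AddCommGroup A] (D : A →+ A)
    (hD : Function.Injective D) {Λ Q : AddSubgroup A} (hΛQ : Λ ≤ Q) (hDΛ : Λ.map D ≤ Λ)
    (hDQ : Q.map D ≤ Q) (hfin : Λ.relIndex Q ≠ 0) :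
    (Q.map D).relIndex Q = (Λ.map D).relIndex Λ := by
  have h1 := AddSubgroup.relIndex_mul_relIndex _ _ _ hDΛ hΛQ
  have h2 := AddSubgroup.relIndex_mul_relIndex _ _ _ (AddSubgroup.map_mono (f := D) hΛQ) hDQ
  rw [AddSubgroup.relIndex_map_map_of_injective _ _ hD, ← h1, mul_comm] at h2
  exact Nat.eq_of_mul_eq_mul_right (Nat.pos_of_ne_zero hfin) h2

/-- A polynomial with integral coefficients is its value at `1` up to an integral multiple of
`X - 1`. -/
lemma exists_eq_eval_one_add {w : L[X]} (hw : CoeffBound 1 w) :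
    ∃ h : L[X], CoeffBound 1 h ∧ w = C (w.eval 1) + (X - 1) * h := by
  have h1 : (X - 1 : L[X]) ∣ w - C (w.eval 1) := by
    have := X_sub_C_dvd_sub_C_eval (a := (1 : L)) (p := w)
    simpa using this
  obtain ⟨h, hh⟩ := h1
  refine ⟨h, ?_, by rw [← hh]; ring⟩
  have hm : (X - 1 : L[X]).Monic := by simpa using monic_X_sub_C (1 : L)
  refine CoeffBound.of_monic_mul hm (by simpa using CoeffBound.X_pow_sub_one (L := L) 1) ?_
  rw [← hh]
  exact hw.sub ((CoeffBound.const _).mono (hw.eval (by simp)))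

/-- For a monic integral polynomial `E` with `E(1) = xy`, the congruence `F ≡ u G` modulo `E`
has an integral solution with `F(1)` or `G(1)` not too small. -/
lemma exists_integral_congruence (p : ℕ) [Fact p.Prime] [NormedAlgebra ℚ_[p] L]
    [FiniteDimensional ℚ_[p] L] {E : L[X]} (hE : E.Monic) (hE1 : CoeffBound 1 E) (u : L[X])
    {x y : L} (hx0 : x ≠ 0) (hy0 : y ≠ 0) (hx1 : ‖x‖ ≤ 1) (hy1 : ‖y‖ ≤ 1)
    (hxy : ‖E.eval 1‖ = ‖x * y‖) :
    ∃ F G : L[X], CoeffBound 1 F ∧ CoeffBound 1 G ∧ E ∣ F - u * G ∧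
      (‖x‖ ≤ ‖F.eval 1‖ ∨ ‖y‖ ≤ ‖G.eval 1‖) := by
  have hX1 : CoeffBound 1 (X - 1 : L[X]) := by simpa using CoeffBound.X_pow_sub_one (L := L) 1
  let mk : L[X] →+* AdjoinRoot E := AdjoinRoot.mk E
  let O := closedBallSubgroup L 1
  have hO (z : L) : z ∈ O ↔ ‖z‖ ≤ 1 := mem_closedBallSubgroup zero_le_one
  let D : AdjoinRoot E →+ AdjoinRoot E := AddMonoidHom.mulLeft (mk (X - 1))
  let U : AdjoinRoot E →+ AdjoinRoot E := AddMonoidHom.mulLeft (mk u)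
  let Λ : AddSubgroup (AdjoinRoot E) := (integralPolys L).map mk.toAddMonoidHom
  have hmkΛ {w : L[X]} (hw : CoeffBound 1 w) : mk w ∈ Λ := ⟨w, hw, rfl⟩
  let Q := Λ ⊔ Λ.map U
  have hE0 : E.eval 1 ≠ 0 := by
    rw [← norm_ne_zero_iff, hxy, norm_ne_zero_iff]; exact mul_ne_zero hx0 hy0
  have hDinj : Function.Injective D := by
    rw [injective_iff_map_eq_zero]
    intro z hz
    obtain ⟨w, rfl⟩ := AdjoinRoot.mk_surjective z
    change mk (X - 1) * mk w = 0 at hz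
    rw [← map_mul, AdjoinRoot.mk_eq_zero] at hz
    rw [AdjoinRoot.mk_eq_zero]
    refine IsCoprime.dvd_of_dvd_mul_left ?_ hz
    have := (irreducible_X_sub_C (1 : L)).coprime_iff_not_dvd.mpr
      (fun h => hE0 (dvd_iff_isRoot.mp h))
    simpa using this.symm
  have hDΛ : Λ.map D ≤ Λ := by
    rintro _ ⟨_, ⟨w, hw, rfl⟩, rfl⟩
    exact ⟨(X - 1) * w, hX1.mul_of_one_left hw, map_mul mk _ _⟩
  have hDQ : Q.map D ≤ Q := by
    rw [AddSubgroup.map_sup]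
    refine sup_le_sup hDΛ ?_
    rintro _ ⟨_, ⟨z, hz, rfl⟩, rfl⟩
    refine ⟨D z, hDΛ ⟨z, hz, rfl⟩, ?_⟩
    change mk u * (mk (X - 1) * z) = mk (X - 1) * (mk u * z)
    ring
  have hfin : Λ.relIndex Q ≠ 0 := by
    rw [AddSubgroup.relIndex_sup_left]
    obtain ⟨c, hc, hcu⟩ := exists_coeffBound u
    obtain ⟨S, hS, hcov⟩ := exists_finite_poly_cover (L := L) p (E.natDegree + 1) (inv_pos.mpr hc)
    refine relIndex_ne_zero_of_finite_cover _ _ ((fun s => mk (u * s)) '' S) (hS.image _) ?_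
    rintro _ ⟨_, ⟨w, hw, rfl⟩, rfl⟩
    have hdeg : (w %ₘ E).natDegree < E.natDegree + 1 :=
      Nat.lt_succ_of_le (natDegree_modByMonic_le _ hE)
    obtain ⟨s, hs, hb⟩ := hcov _ (CoeffBound.modByMonic hE hE1 hw) hdeg
    refine ⟨_, ⟨s, hs, rfl⟩, u * (w %ₘ E - s), ?_, ?_⟩
    · have := hcu.mul hb
      rwa [mul_inv_cancel₀ hc.ne'] at this
    · change mk (u * (w %ₘ E - s)) = mk u * mk w - mk (u * s)
      rw [← map_mul, ← map_sub, AdjoinRoot.mk_eq_mk]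
      refine ⟨-(u * (w /ₘ E)), ?_⟩
      rw [modByMonic_eq_sub_mul_div]; ring
  have hind := relIndex_map_eq_of_finite D hDinj le_sup_left hDΛ hDQ hfin
  let κ : L →+ AdjoinRoot E := mk.toAddMonoidHom.comp (C : L →+* L[X]).toAddMonoidHom
  have hκ (z : L) : κ z = mk (C z) := rfl
  have hΛ : Λ = O.map κ ⊔ Λ.map D := by
    refine le_antisymm ?_ (sup_le ?_ hDΛ)
    · rintro _ ⟨w, hw, rfl⟩
      obtain ⟨h, hh, e⟩ := exists_eq_eval_one_add hw
      have h1 : mk w = κ (w.eval 1) + D (mk h) := by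
        conv_lhs => rw [e, map_add, map_mul]
        rfl
      change mk w ∈ _
      rw [h1]
      exact AddSubgroup.add_mem_sup ⟨_, (hO _).mpr (hw.eval (by simp)), rfl⟩ ⟨_, hmkΛ hh, rfl⟩
    · rintro _ ⟨z, hz, rfl⟩
      exact hmkΛ ((CoeffBound.const z).mono ((hO z).mp hz))
  have hball : closedBallSubgroup L ‖x * y‖ ≤ (Λ.map D).comap κ := by
    intro z hz
    rw [mem_closedBallSubgroup (norm_nonneg _), ← hxy] at hz
    obtain ⟨h, hh, e⟩ := exists_eq_eval_one_add hE1
    have hz' : ‖z / E.eval 1‖ ≤ 1 := by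
      rw [norm_div]; exact div_le_one_of_le₀ hz (norm_nonneg _)
    refine ⟨mk (-(C (z / E.eval 1) * h)), hmkΛ ?_, ?_⟩
    · exact (((CoeffBound.const _).mul hh).neg).mono (by simpa using hz')
    · change mk (X - 1) * mk (-(C (z / E.eval 1) * h)) = mk (C z)
      rw [← map_mul, AdjoinRoot.mk_eq_mk]
      refine ⟨-C (z / E.eval 1), ?_⟩
      have h2 : C z = C (z / E.eval 1) * C (E.eval 1) := by
        rw [← C_mul, div_mul_cancel₀ _ hE0]
      rw [h2]
      linear_combination C (z / E.eval 1) * e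
  have hxy0 : 0 < ‖x * y‖ := norm_pos_iff.mpr (mul_ne_zero hx0 hy0)
  have hI0 := closedBall_relIndex_ne_zero (L := L) p hxy0
  have hrel : (Λ.map D).relIndex Λ = ((Λ.map D).comap κ).relIndex O := by
    have h1 := congrArg (Λ.map D).relIndex hΛ
    rw [AddSubgroup.relIndex_sup_right] at h1
    rw [h1, AddSubgroup.relIndex_comap]
  have hle : (Λ.map D).relIndex Λ ≤ (closedBallSubgroup L ‖x * y‖).relIndex O := by
    rw [hrel]
    exact AddSubgroup.relIndex_le_of_le_left hball hI0
  have hne : (Λ.map D).relIndex Λ ≠ 0 := by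
    rw [hrel]
    exact fun h => hI0 (AddSubgroup.relIndex_eq_zero_of_le_left hball h)
  let ψ : L × L →+ AdjoinRoot E :=
    κ.comp (AddMonoidHom.fst L L) - U.comp (κ.comp (AddMonoidHom.snd L L))
  have hψ (z : L × L) : ψ z = mk (C z.1) - mk u * mk (C z.2) := rfl
  have hψQ : (O.prod O).map ψ ≤ Q := by
    rintro _ ⟨z, hz, rfl⟩
    rw [hψ]
    refine Q.sub_mem (AddSubgroup.mem_sup_left (hmkΛ ((CoeffBound.const _).mono
      ((hO _).mp hz.1)))) (AddSubgroup.mem_sup_right ⟨_, hmkΛ ((CoeffBound.const _).mono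
      ((hO _).mp hz.2)), rfl⟩)
  have hψind : ((Q.map D).comap ψ).relIndex (O.prod O) ≤ (Q.map D).relIndex Q := by
    rw [AddSubgroup.relIndex_comap]
    exact AddSubgroup.relIndex_le_of_le_right hψQ (hind ▸ hne)
  have hψne : ((Q.map D).comap ψ).relIndex (O.prod O) ≠ 0 := by
    rw [AddSubgroup.relIndex_comap]
    exact fun h => hind ▸ hne <| AddSubgroup.relIndex_eq_zero_of_le_right hψQ h
  have hxp : 0 < ‖x‖ := norm_pos_iff.mpr hx0
  have hyp : 0 < ‖y‖ := norm_pos_iff.mpr hy0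
  have key : ∃ z ∈ O.prod O, z ∈ (Q.map D).comap ψ ∧ (‖x‖ ≤ ‖z.1‖ ∨ ‖y‖ ≤ ‖z.2‖) := by
    by_contra! hcon
    let H := (openBallSubgroup L ‖x‖ hxp).comap (AddMonoidHom.fst L L) ⊓
      (openBallSubgroup L ‖y‖ hyp).comap (AddMonoidHom.snd L L)
    have h1 : (Q.map D).comap ψ ⊓ O.prod O ≤ H := fun z hz =>
      ⟨(hcon z hz.2 hz.1).1, (hcon z hz.2 hz.1).2⟩
    have h2 := AddSubgroup.relIndex_le_of_le_left (L := O.prod O) h1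
      (by rwa [AddSubgroup.inf_relIndex_right])
    rw [AddSubgroup.inf_relIndex_right, closedBall_prod_relIndex hxp hyp] at h2
    have h3 := closedBall_relIndex_lt_openBall p hxp hx1
    have h4 := closedBall_relIndex_lt_openBall p hyp hy1
    have h5 := closedBall_relIndex_mul hx0 hx1 hy1
    have h6 := Nat.mul_lt_mul'' h3 h4
    have h7 := (h2.trans hψind).trans (hind.le.trans hle)
    change _ ≤ (closedBallSubgroup L ‖x * y‖).relIndex (closedBallSubgroup L 1) at h7
    rw [h5, mul_comm (AddSubgroup.relIndex (closedBallSubgroup L ‖y‖) _)] at h7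
    exact absurd h6 (not_lt.mpr h7)
  obtain ⟨z, hzO, ⟨q, hqQ, hq⟩, hz⟩ := key
  obtain ⟨_, ⟨f, hf, rfl⟩, _, ⟨_, ⟨g, hg, rfl⟩, rfl⟩, rfl⟩ := AddSubgroup.mem_sup.mp hqQ
  refine ⟨C z.1 - (X - 1) * f, C z.2 + (X - 1) * g, ?_, ?_, ?_, ?_⟩
  · exact ((CoeffBound.const _).mono ((hO _).mp hzO.1)).sub (hX1.mul_of_one_left hf)
  · exact ((CoeffBound.const _).mono ((hO _).mp hzO.2)).add (hX1.mul_of_one_left hg)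
  · rw [← AdjoinRoot.mk_eq_zero]
    change mk (X - 1) * (mk f + mk u * mk g) = mk (C z.1) - mk u * mk (C z.2) at hq
    change mk _ = 0
    simp only [map_sub, map_add, map_mul] at hq ⊢
    linear_combination -hq
  · simpa using hz

/-- Existence of integral pairs that are not divisible at the trivial level. -/
lemma exists_sol (K : ℕ) [FiniteDimensional ℚ_[p] L] {α β : L} (hα : α ≠ 0) (hβ : β ≠ 0)
    (hα1 : ‖α‖ ≤ 1) (hβ1 : ‖β‖ ≤ 1) (hαβ : ‖α‖ * ‖β‖ = ((p : ℝ)⁻¹) ^ K) {n : ℕ} (hn : n ≠ 0) :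
    ∃ f g : L[X], Sol p K α β n f g ∧ CoeffBound 1 (C (α ^ n) * f) ∧
      CoeffBound 1 (C (β ^ n) * g) ∧ (1 ≤ ‖f.eval 1‖ ∨ 1 ≤ ‖g.eval 1‖) := by
  obtain ⟨u, hu⟩ := exists_interpolation (p := p) K hn (fun e => (α / β) ^ (n - 1 - e))
  obtain ⟨F, G, hF, hG, hd, hor⟩ := exists_integral_congruence p
    ((Epol_monic (p := p) (L := L) n).pow K) ((Epol_bound n).pow_of_one K) u
    (pow_ne_zero n hα) (pow_ne_zero n hβ) (by simpa using pow_le_one₀ (norm_nonneg _) hα1)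
    (by simpa using pow_le_one₀ (norm_nonneg _) hβ1)
    (by rw [norm_mul, norm_pow, norm_pow, ← mul_pow, hαβ, eval_pow, Epol_eval_one, norm_pow,
          norm_pow, norm_natCast_p, ← pow_mul, ← pow_mul, mul_comm])
  have cancel (γ : L) (hγ : γ ≠ 0) (W : L[X]) : C (γ ^ n) * (C ((γ ^ n)⁻¹) * W) = W := by
    rw [← mul_assoc, ← C_mul, mul_inv_cancel₀ (pow_ne_zero n hγ), C_1, one_mul]
  refine ⟨C ((α ^ n)⁻¹) * F, C ((β ^ n)⁻¹) * G, ?_, by rwa [cancel α hα], by rwa [cancel β hβ], ?_⟩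
  · intro e he
    have h1 : C (α ^ (e + 1)) * (C ((α ^ n)⁻¹) * F) - C (β ^ (e + 1)) * (C ((β ^ n)⁻¹) * G) =
        C (α ^ (e + 1) * (α ^ n)⁻¹) * ((F - u * G) + (u - C ((α / β) ^ (n - 1 - e))) * G) := by
      have h2 : β ^ (e + 1) * (β ^ n)⁻¹ =
          α ^ (e + 1) * (α ^ n)⁻¹ * (α / β) ^ (n - 1 - e) := by
        obtain ⟨m, rfl⟩ : ∃ m, n = m + e + 1 := ⟨n - 1 - e, by omega⟩
        have : m + e + 1 - 1 - e = m := by omega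
        rw [this, div_pow]
        field_simp
        ring
      rw [← mul_assoc, ← mul_assoc, ← C_mul, ← C_mul, h2, C_mul (a := α ^ (e + 1) * (α ^ n)⁻¹)]
      ring
    rw [h1]
    refine Dvd.dvd.mul_left ?_ _
    exact ((pow_dvd_pow_of_dvd (Phi_dvd_Epol he) K).trans hd).add ((hu e he).mul_right _)
  · have hα' : 0 < ‖α ^ n‖ := norm_pos_iff.mpr (pow_ne_zero n hα)
    have hβ' : 0 < ‖β ^ n‖ := norm_pos_iff.mpr (pow_ne_zero n hβ)
    refine hor.imp (fun h => ?_) fun h => ?_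
    · rw [eval_mul, eval_C, norm_mul, norm_inv]
      rwa [inv_mul_eq_div, one_le_div hα']
    · rw [eval_mul, eval_C, norm_mul, norm_inv]
      rwa [inv_mul_eq_div, one_le_div hβ']

/-- The pairing of a polynomial, viewed as the combination `∑ cᵢ δᵢ` of Dirac measures at the
natural numbers, with a function on the natural numbers. -/
def pair (u : ℕ → L) : L[X] →ₗ[L] L := lsum fun i => LinearMap.toSpanSingleton L L (u i)

lemma pair_apply (u : ℕ → L) (w : L[X]) :
    pair u w = ∑ i ∈ w.support, w.coeff i * u i := by
  simp [pair, sum_def]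

lemma pair_monomial (u : ℕ → L) (n : ℕ) (c : L) : pair u (monomial n c) = c * u n := by
  simp [pair]

lemma pair_X_pow (u : ℕ → L) (n : ℕ) : pair u (X ^ n) = u n := by
  rw [X_pow_eq_monomial, pair_monomial, one_mul]

lemma pair_C_mul (u : ℕ → L) (c : L) (w : L[X]) : pair u (C c * w) = c * pair u w := by
  rw [← smul_eq_C_mul, map_smul, smul_eq_mul]

lemma pair_add_left (u v : ℕ → L) (w : L[X]) : pair (u + v) w = pair u w + pair v w := by
  simp [pair_apply, mul_add, Finset.sum_add_distrib]

lemma pair_sub_left (u v : ℕ → L) (w : L[X]) : pair (u - v) w = pair u w - pair v w := by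
  simp [pair_apply, mul_sub, Finset.sum_sub_distrib]

lemma pair_smul_left (c : L) (u : ℕ → L) (w : L[X]) : pair (c • u) w = c * pair u w := by
  simp only [pair_apply, Pi.smul_apply, smul_eq_mul, Finset.mul_sum]
  exact Finset.sum_congr rfl fun i _ => by ring

lemma pair_zero_left (w : L[X]) : pair 0 w = 0 := by simp [pair_apply]

lemma pair_sum_left {ι : Type*} (s : Finset ι) (u : ι → ℕ → L) (w : L[X]) :
    pair (∑ i ∈ s, u i) w = ∑ i ∈ s, pair (u i) w := by
  classical
  induction s using Finset.induction_on with
  | empty => simp [pair_zero_left]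
  | insert a s ha ih => rw [Finset.sum_insert ha, Finset.sum_insert ha, pair_add_left, ih]

lemma norm_pair_le {u : ℕ → L} {w : L[X]} {c d : ℝ} (hw : CoeffBound c w) (hd : 0 ≤ d)
    (hu : ∀ i, ‖u i‖ ≤ d) : ‖pair u w‖ ≤ c * d := by
  rw [pair_apply]
  refine IsUltrametricDist.norm_sum_le_of_forall_le_of_nonneg (mul_nonneg hw.nonneg hd) ?_
  intro i _
  rw [norm_mul]
  exact mul_le_mul (hw i) (hu i) (norm_nonneg _) hw.nonneg

lemma pair_X_pow_mul (u : ℕ → L) (j : ℕ) (w : L[X]) :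
    pair u (X ^ j * w) = pair (fun i => u (i + j)) w := by
  induction w using Polynomial.induction_on' with
  | add v w hv hw => rw [mul_add, map_add, map_add, hv, hw]
  | monomial n c =>
    rw [X_pow_eq_monomial, monomial_mul_monomial, one_mul, pair_monomial, pair_monomial, add_comm]

lemma pair_one (w : L[X]) : pair (fun _ => 1) w = w.eval 1 := by
  rw [pair_apply, eval_eq_sum, sum_def]; simp

/-- The operator on measures dual to multiplication by `z - a`. -/
def shiftMul (a : L) (w : L[X]) : L[X] := X * derivative w - C a * w

lemma pair_shiftMul (a : L) (u : ℕ → L) (w : L[X]) :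
    pair u (shiftMul a w) = pair (fun i => ((i : L) - a) * u i) w := by
  induction w using Polynomial.induction_on' with
  | add v w hv hw =>
    have : shiftMul a (v + w) = shiftMul a v + shiftMul a w := by
      simp only [shiftMul, derivative_add]; ring
    rw [this, map_add, map_add, hv, hw]
  | monomial n c =>
    rw [shiftMul, derivative_monomial, map_sub, pair_C_mul, pair_monomial]
    cases n with
    | zero => rw [pair_monomial]; simp; ring
    | succ n =>
      rw [X_mul_monomial, Nat.add_sub_cancel, pair_monomial, pair_monomial]
      ring

lemma pair_iterate_shiftMul (a : L) (u : ℕ → L) (j : ℕ) (w : L[X]) :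
    pair u ((shiftMul a)^[j] w) = pair (fun i => ((i : L) - a) ^ j * u i) w := by
  induction j generalizing w with
  | zero => simp
  | succ j ih =>
    rw [Function.iterate_succ_apply, ih, pair_shiftMul]
    congr 2; ext i; ring

lemma pow_dvd_shiftMul {Q w : L[X]} {m : ℕ} (a : L) (h : Q ^ (m + 1) ∣ w) :
    Q ^ m ∣ shiftMul a w := by
  obtain ⟨q, rfl⟩ := h
  rw [shiftMul, derivative_mul, derivative_pow_succ, pow_succ]
  refine ⟨X * (C ((m : L) + 1) * derivative Q * q + Q * derivative q) - C a * (Q * q), ?_⟩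
  ring

lemma dvd_iterate_shiftMul {Q w : L[X]} {K : ℕ} (a : L) (h : Q ^ K ∣ w) {j : ℕ} (hj : j ≤ K) :
    Q ^ (K - j) ∣ (shiftMul a)^[j] w := by
  induction j with
  | zero => simpa using h
  | succ j ih =>
    rw [Function.iterate_succ_apply']
    refine pow_dvd_shiftMul a ?_
    have := ih (by omega)
    rwa [show K - j = K - (j + 1) + 1 by omega] at this

lemma dvd_iterate_shiftMul_of_lt {Q w : L[X]} {K : ℕ} (a : L) (h : Q ^ K ∣ w) {j : ℕ}
    (hj : j < K) : Q ∣ (shiftMul a)^[j] w :=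
  (dvd_pow_self Q (by omega)).trans (dvd_iterate_shiftMul a h hj.le)

lemma pair_sub_pow_eq_zero {w : L[X]} {K : ℕ} (h : (X - 1) ^ K ∣ w) (a : L) {j : ℕ}
    (hj : j < K) : pair (fun i => ((i : L) - a) ^ j) w = 0 := by
  have h1 := pair_iterate_shiftMul a (fun _ => 1) j w
  simp only [mul_one] at h1
  rw [← h1, pair_one]
  obtain ⟨q, hq⟩ := dvd_iterate_shiftMul_of_lt a h hj
  simp [hq]

lemma pair_X_sub_one_pow (f : ℤ_[p] → L) (n : ℕ) :
    pair (fun i : ℕ => f i) ((X - 1) ^ n) = mahlerCoeff p L f n := by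
  rw [mahlerCoeff, sub_eq_add_neg, add_comm, add_pow, map_sum]
  refine Finset.sum_congr rfl fun i hi => ?_
  have : ((-1 : L[X]) ^ i * X ^ (n - i) * (n.choose i : L[X])) =
      C ((-1) ^ i * (n.choose i : L)) * X ^ (n - i) := by
    simp only [map_mul, map_pow, map_neg, C_1, map_natCast]; ring
  rw [this, pair_C_mul, pair_X_pow]

lemma pair_eq_sum_mahler (f : ℤ_[p] → L) (w : L[X]) :
    pair (fun i : ℕ => f i) w =
      ∑ m ∈ (taylor 1 w).support, (taylor 1 w).coeff m * mahlerCoeff p L f m := by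
  conv_lhs => rw [← sum_taylor_eq w 1, sum_def, map_sum]
  refine Finset.sum_congr rfl fun m _ => ?_
  rw [pair_C_mul, C_1, pair_X_sub_one_pow]

lemma coeff_mul_le_of_le {v w : L[X]} {c d : ℝ} {m : ℕ} (hc : 0 ≤ c) (hd : 0 ≤ d)
    (hv : ∀ i ≤ m, ‖v.coeff i‖ ≤ c) (hw : ∀ i ≤ m, ‖w.coeff i‖ ≤ d) :
    ∀ i ≤ m, ‖(v * w).coeff i‖ ≤ c * d := by
  intro i hi
  rw [coeff_mul]
  refine IsUltrametricDist.norm_sum_le_of_forall_le_of_nonneg (mul_nonneg hc hd) ?_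
  intro x hx
  have := Finset.HasAntidiagonal.mem_antidiagonal.mp hx
  rw [norm_mul]
  exact mul_le_mul (hv _ (by omega)) (hw _ (by omega)) (norm_nonneg _) hc

lemma coeff_pow_le_of_le {v : L[X]} {c : ℝ} {m : ℕ} (hc : 0 ≤ c)
    (hv : ∀ i ≤ m, ‖v.coeff i‖ ≤ c) (n : ℕ) : ∀ i ≤ m, ‖(v ^ n).coeff i‖ ≤ c ^ n := by
  induction n with
  | zero => intro i _; simpa using CoeffBound.one i
  | succ n ih => rw [pow_succ, pow_succ]; exact coeff_mul_le_of_le (by positivity) hc ih hv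

lemma taylor_Ypol_coeff (e i : ℕ) :
    (taylor 1 (Ypol p L e)).coeff i = if i = 0 then 0 else ((p ^ e).choose i : L) := by
  have : taylor 1 (Ypol p L e) = (X + 1) ^ (p ^ e) - 1 := by
    simp [Ypol, taylor_apply]
  rw [this, coeff_sub, coeff_X_add_one_pow, coeff_one]
  split_ifs with h <;> simp [h]

lemma norm_taylor_Ypol_coeff_le (e i : ℕ) :
    ‖(taylor 1 (Ypol p L e)).coeff i‖ ≤ min 1 (i * ((p : ℝ)⁻¹) ^ e) := by
  rw [taylor_Ypol_coeff]
  split_ifs with h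
  · simp [h]
  · exact le_min (IsUltrametricDist.norm_natCast_le_one L _) (norm_choose_prime_pow_le h)

lemma norm_taylor_Ypol_pow_mul_coeff_le (K e m : ℕ) {h : L[X]} {c : ℝ} (hh : CoeffBound c h) :
    ‖(taylor 1 (Ypol p L e ^ K * h)).coeff m‖ ≤ (min 1 (m * ((p : ℝ)⁻¹) ^ e)) ^ K * c := by
  rw [taylor_mul, taylor_pow]
  have hμ : (0 : ℝ) ≤ min 1 (m * ((p : ℝ)⁻¹) ^ e) := by positivity
  refine coeff_mul_le_of_le (by positivity) hh.nonneg (coeff_pow_le_of_le hμ (fun i hi => ?_) K)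
    (fun i _ => hh.taylor_one i) m le_rfl
  refine (norm_taylor_Ypol_coeff_le e i).trans (min_le_min_left _ ?_)
  gcongr

lemma prime_cast_pos (p : ℕ) [Fact p.Prime] : (0 : ℝ) < p := by
  exact_mod_cast (Fact.out : p.Prime).pos

lemma one_lt_prime_cast (p : ℕ) [Fact p.Prime] : (1 : ℝ) < p := by
  exact_mod_cast (Fact.out : p.Prime).one_lt

lemma rpow_mul_min_pow_le (p : ℕ) [Fact p.Prime] {r : ℝ} {K : ℕ} (hr : 0 < r) (hrK : r ≤ K)
    (e m : ℕ) :
    ((p : ℝ) ^ r) ^ e * (min 1 (m * ((p : ℝ)⁻¹) ^ e)) ^ K ≤ (m : ℝ) ^ r := by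
  have hp := prime_cast_pos p
  set t : ℝ := min 1 (m * ((p : ℝ)⁻¹) ^ e) with ht
  have ht0 : 0 ≤ t := by positivity
  have ht1 : t ≤ 1 := min_le_left _ _
  have h1 : t ^ K ≤ t ^ r := by
    rw [← Real.rpow_natCast]
    rcases ht0.eq_or_lt with h | h
    · rw [← h, Real.zero_rpow hr.ne', Real.zero_rpow (hr.trans_le hrK).ne']
    · exact Real.rpow_le_rpow_of_exponent_ge h ht1 hrK
  have h2 : t ^ r ≤ (m * ((p : ℝ)⁻¹) ^ e) ^ r := Real.rpow_le_rpow ht0 (min_le_right _ _) hr.le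
  calc ((p : ℝ) ^ r) ^ e * t ^ K ≤ ((p : ℝ) ^ r) ^ e * (m * ((p : ℝ)⁻¹) ^ e) ^ r := by
        gcongr; exact h1.trans h2
    _ = (m : ℝ) ^ r := by
        rw [Real.mul_rpow (by positivity) (by positivity), ← Real.rpow_natCast, ← Real.rpow_mul hp.le,
          ← Real.rpow_natCast, ← Real.rpow_mul (by positivity), Real.inv_rpow hp.le, mul_comm r,
          mul_comm, mul_assoc, inv_mul_cancel₀ (by positivity), mul_one]

/-- A polynomial whose reductions modulo the powers of `X ^ (p ^ e) - 1` grow like `α ^ (-e)`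
defines a distribution of order `r`, where `‖α‖ = p ^ (-r)`. -/
lemma norm_taylor_coeff_le {r : ℝ} {K N : ℕ} (hr : 0 < r) (hrK : r ≤ K) {α : L} (hα : α ≠ 0)
    (hαr : ‖α‖⁻¹ = (p : ℝ) ^ r) {S : ℝ} {w : L[X]}
    (hmod : ∀ e ≤ N, ModBound p K e S (C (α ^ e) * w)) (hw : CoeffBound S (C (α ^ N) * w))
    (m : ℕ) : ‖(taylor 1 w).coeff m‖ ≤ S * (p : ℝ) ^ r * ((m : ℝ) + 1) ^ r := by
  have hp := one_lt_prime_cast p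
  have hS : 0 ≤ S := hw.nonneg
  have hpr : 1 ≤ (p : ℝ) ^ r := Real.one_le_rpow hp.le hr.le
  have hm1 : 1 ≤ ((m : ℝ) + 1) ^ r := Real.one_le_rpow (by linarith [m.cast_nonneg (α := ℝ)]) hr.le
  have cancel (e : ℕ) (W : L[X]) : C ((α ^ e)⁻¹) * (C (α ^ e) * W) = W := by
    rw [← mul_assoc, ← C_mul, inv_mul_cancel₀ (pow_ne_zero e hα), C_1, one_mul]
  have hex : ∀ e ≤ N, ∃ R, CoeffBound (S * ((p : ℝ) ^ r) ^ e) R ∧ Ypol p L e ^ K ∣ w - R ∧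
      (e = N → R = w) := by
    intro e he
    have hnorm (W : L[X]) (hW : CoeffBound S W) :
        CoeffBound (S * ((p : ℝ) ^ r) ^ e) (C ((α ^ e)⁻¹) * W) := by
      have := (CoeffBound.const ((α ^ e)⁻¹)).mul hW
      rwa [norm_inv, norm_pow, ← inv_pow, hαr, mul_comm] at this
    by_cases heN : e = N
    · subst heN
      refine ⟨w, ?_, by simp, fun _ => rfl⟩
      have := hnorm _ hw
      rwa [cancel] at this
    · obtain ⟨R, hR, hd⟩ := hmod e he
      refine ⟨C ((α ^ e)⁻¹) * R, hnorm R hR, ?_, fun h => absurd h heN⟩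
      have := hd.mul_left (C ((α ^ e)⁻¹))
      rwa [mul_sub, cancel] at this
  choose! R hR hdvd hRN using hex
  have main : ∀ e ≤ N, ‖(taylor 1 (R e)).coeff m‖ ≤ S * (p : ℝ) ^ r * ((m : ℝ) + 1) ^ r := by
    intro e
    induction e with
    | zero =>
      intro _
      refine ((hR 0 (Nat.zero_le _)).taylor_one m).trans ?_
      rw [pow_zero, mul_one, mul_assoc]
      exact le_mul_of_one_le_right hS (one_le_mul_of_one_le_of_one_le hpr hm1)
    | succ e ih =>
      intro he
      have hd : Ypol p L e ^ K ∣ R (e + 1) - R e := by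
        have h1 := (pow_dvd_pow_of_dvd (Ypol_dvd_succ (p := p) (L := L) e) K).trans
          (hdvd (e + 1) he)
        have h2 := (hdvd e (by omega)).sub h1
        simpa using h2
      obtain ⟨h, hh⟩ := hd
      have hb : CoeffBound (S * ((p : ℝ) ^ r) ^ (e + 1)) h := by
        refine CoeffBound.of_monic_mul ((Ypol_monic (p := p) e).pow K)
          ((Ypol_bound e).pow_of_one K) ?_
        rw [← hh]
        refine (hR (e + 1) he).sub ((hR e (by omega)).mono ?_)
        gcongr
        omega
      rw [← add_sub_cancel (R e) (R (e + 1)), hh, map_add, coeff_add]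
      refine (IsUltrametricDist.norm_add_le_max _ _).trans (max_le (ih (by omega)) ?_)
      refine (norm_taylor_Ypol_pow_mul_coeff_le K e m hb).trans ?_
      have h3 := rpow_mul_min_pow_le p hr hrK e m
      calc _ = S * (p : ℝ) ^ r * (((p : ℝ) ^ r) ^ e * (min 1 (m * ((p : ℝ)⁻¹) ^ e)) ^ K) := by
            rw [pow_succ]; ring
        _ ≤ S * (p : ℝ) ^ r * ((m : ℝ) + 1) ^ r := by
            gcongr
            refine h3.trans (Real.rpow_le_rpow (by positivity) (by linarith) hr.le)
  have := main N le_rfl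
  rwa [hRN N le_rfl rfl] at this

lemma norm_pair_le_of_mahler {r : ℝ} {K N : ℕ} (hr : 0 < r) (hrK : r ≤ K) {α : L} (hα : α ≠ 0)
    (hαr : ‖α‖⁻¹ = (p : ℝ) ^ r) {S : ℝ} {w : L[X]}
    (hmod : ∀ e ≤ N, ModBound p K e S (C (α ^ e) * w)) (hw : CoeffBound S (C (α ^ N) * w))
    {f : ℤ_[p] → L} {M : ℝ} (hf : ∀ n : ℕ, ((n : ℝ) + 1) ^ r * ‖mahlerCoeff p L f n‖ ≤ M) :
    ‖pair (fun i : ℕ => f i) w‖ ≤ S * (p : ℝ) ^ r * M := by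
  have hS : 0 ≤ S := hw.nonneg
  have hM : 0 ≤ M := le_trans (by positivity) (hf 0)
  rw [pair_eq_sum_mahler]
  refine IsUltrametricDist.norm_sum_le_of_forall_le_of_nonneg (by positivity) fun m _ => ?_
  rw [norm_mul]
  calc _ ≤ S * (p : ℝ) ^ r * ((m : ℝ) + 1) ^ r * ‖mahlerCoeff p L f m‖ := by
        gcongr; exact norm_taylor_coeff_le hr hrK hα hαr hmod hw m
    _ = S * (p : ℝ) ^ r * (((m : ℝ) + 1) ^ r * ‖mahlerCoeff p L f m‖) := by ring
    _ ≤ _ := by gcongr; exact hf m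

lemma Epol_modBound_zero (K d : ℕ) : ModBound p K 0 (K * ((p : ℝ)⁻¹) ^ d) (Epol p L d) := by
  have hcoeff (i : ℕ) : (taylor 1 (Epol p L d)).coeff i = ((p ^ d).choose (i + 1) : L) := by
    have h1 := taylor_Ypol_coeff (p := p) (L := L) d (i + 1)
    rw [← Epol_mul, taylor_mul] at h1
    simpa [coeff_mul_X] using h1
  refine ⟨∑ i ∈ Finset.range K, C ((p ^ d).choose (i + 1) : L) * (X - 1) ^ i, ?_, ?_⟩
  · refine CoeffBound.sum (by positivity) _ _ fun i hi => ?_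
    have h1 : CoeffBound 1 ((X - 1 : L[X]) ^ i) := CoeffBound.pow_of_one
      (by simpa using CoeffBound.X_pow_sub_one (L := L) 1) i
    have := (CoeffBound.const ((p ^ d).choose (i + 1) : L)).mul h1
    refine this.mono ?_
    rw [mul_one]
    refine (norm_choose_prime_pow_le (Nat.succ_ne_zero i)).trans ?_
    gcongr
    exact_mod_cast Finset.mem_range.mp hi
  · rw [Ypol_zero]
    have h2 : Epol p L d = ∑ i ∈ Finset.range ((taylor 1 (Epol p L d)).natDegree + 1 + K),
        C ((p ^ d).choose (i + 1) : L) * (X - 1) ^ i := by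
      conv_lhs => rw [← sum_taylor_eq (Epol p L d) 1]
      rw [sum_over_range' _ (by simp) ((taylor 1 (Epol p L d)).natDegree + 1 + K) (by omega)]
      simp only [hcoeff, C_1]
    rw [h2, add_comm _ K, Finset.sum_range_add, add_sub_cancel_left]
    exact Finset.dvd_sum fun i _ => Dvd.dvd.mul_left (pow_dvd_pow _ (by omega)) _

variable (L) in
/-- The indicator function of the ball `a + p ^ m ℤ_p`. -/
def ballInd (a : ℤ_[p]) (m : ℕ) (z : ℤ_[p]) : L := if (p : ℤ_[p]) ^ m ∣ z - a then 1 else 0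

lemma ballInd_zero (a z : ℤ_[p]) : ballInd L a 0 z = 1 := by simp [ballInd]

lemma sum_ballInd_succ (a : ℤ_[p]) (m : ℕ) (z : ℤ_[p]) :
    ∑ j ∈ Finset.range p, ballInd L a (m + 1) (z + (p : ℤ_[p]) ^ m * j) = ballInd L a m z := by
  have hp0 : (p : ℤ_[p]) ≠ 0 := by exact_mod_cast (Fact.out : p.Prime).ne_zero
  by_cases h : (p : ℤ_[p]) ^ m ∣ z - a
  · obtain ⟨t, ht⟩ := h
    have key : ∀ j : ℕ, ballInd L a (m + 1) (z + (p : ℤ_[p]) ^ m * j) =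
        if (p : ℤ_[p]) ∣ t + j then 1 else 0 := by
      intro j
      have : z + (p : ℤ_[p]) ^ m * j - a = (p : ℤ_[p]) ^ m * (t + j) := by
        rw [mul_add, ← ht]; ring
      rw [ballInd, this, pow_succ, mul_dvd_mul_iff_left (pow_ne_zero m hp0)]
    obtain ⟨n, ⟨hn, hnt⟩, huniq⟩ := PadicInt.existsUnique_mem_range (x := -t)
    have hmem : ∀ x : ℤ_[p], x ∈ IsLocalRing.maximalIdeal ℤ_[p] ↔ (p : ℤ_[p]) ∣ x := fun x => by
      rw [PadicInt.maximalIdeal_eq_span_p, Ideal.mem_span_singleton]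
    rw [Finset.sum_congr rfl fun j _ => key j, Finset.sum_eq_single n]
    · rw [if_pos, ballInd, if_pos (Dvd.intro _ ht.symm)]
      rw [hmem] at hnt
      rw [show t + (n : ℤ_[p]) = -(-t - n) by ring]
      exact (dvd_neg).2 hnt
    · intro j hj hne
      rw [if_neg]
      intro hd
      refine hne (huniq j ⟨Finset.mem_range.1 hj, ?_⟩)
      rw [hmem, show -t - (j : ℤ_[p]) = -(t + j) by ring]
      exact (dvd_neg).2 hd
    · intro h; exact absurd (Finset.mem_range.2 hn) h
  · rw [ballInd, if_neg h]
    refine Finset.sum_eq_zero fun j _ => ?_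
    rw [ballInd, if_neg]
    intro hd
    apply h
    have h1 : (p : ℤ_[p]) ^ m ∣ z + (p : ℤ_[p]) ^ m * j - a := (pow_dvd_pow _ m.le_succ).trans hd
    have h2 : (p : ℤ_[p]) ^ m ∣ (p : ℤ_[p]) ^ m * j := Dvd.intro _ rfl
    have := dvd_sub h1 h2
    rwa [show z + (p : ℤ_[p]) ^ m * j - a - (p : ℤ_[p]) ^ m * j = z - a by ring] at this

lemma ballInd_add_pow_mul (a : ℤ_[p]) (m : ℕ) (z : ℤ_[p]) (j : ℕ) :
    ballInd L a m (z + (p : ℤ_[p]) ^ m * j) = ballInd L a m z := by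
  unfold ballInd
  congr 1
  rw [show z + (p : ℤ_[p]) ^ m * j - a = z - a + (p : ℤ_[p]) ^ m * j by ring]
  exact propext (dvd_add_left (Dvd.intro _ rfl))

lemma pair_ballInd_succ (a : ℤ_[p]) (m : ℕ) {w : L[X]} (h : Phi p L m ∣ w) :
    (p : L) * pair (fun n : ℕ => ballInd L a (m + 1) n) w =
      pair (fun n : ℕ => ballInd L a m n) w := by
  obtain ⟨q, rfl⟩ := h
  have h1 : ∀ e : ℕ, pair (fun n : ℕ => ballInd L a e n) (Phi p L m * q) =
      pair (fun n : ℕ => ∑ j ∈ Finset.range p, ballInd L a e (n + (p : ℤ_[p]) ^ m * j)) q := by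
    intro e
    rw [Phi, Finset.sum_mul, map_sum]
    have : (fun n : ℕ => ∑ j ∈ Finset.range p, ballInd L a e (n + (p : ℤ_[p]) ^ m * j)) =
      ∑ j ∈ Finset.range p, fun n : ℕ => ballInd L a e (n + (p : ℤ_[p]) ^ m * j) := by
      ext n; simp
    rw [this, pair_sum_left]
    refine Finset.sum_congr rfl fun j _ => ?_
    rw [← pow_mul, pair_X_pow_mul]
    push_cast; rfl
  rw [h1, h1]
  simp only [sum_ballInd_succ, ballInd_add_pow_mul, Finset.sum_const, Finset.card_range]
  rw [← pair_smul_left]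
  congr 2; ext n; simp

variable (L) in
/-- The restriction to the ball `a + p ^ m ℤ_p` of the function `z ↦ (z - a) ^ i`. -/
def ballPow (a : ℤ_[p]) (i m : ℕ) (z : ℤ_[p]) : L :=
  ballInd L a m z * (iotaL p L ((z : ℚ_[p]) - a)) ^ i

lemma iotaL_natCast_sub (a : ℤ_[p]) (n : ℕ) :
    iotaL p L (((n : ℤ_[p]) : ℚ_[p]) - a) = (n : L) - iotaL p L a := by
  simp [iotaL]

lemma norm_iotaL (x : ℚ_[p]) : ‖iotaL p L x‖ = ‖x‖ := norm_algebraMap' L x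

lemma norm_iotaL_sub_le {a z : ℤ_[p]} {m : ℕ} (h : (p : ℤ_[p]) ^ m ∣ z - a) :
    ‖iotaL p L ((z : ℚ_[p]) - a)‖ ≤ ((p : ℝ)⁻¹) ^ m := by
  rw [norm_iotaL, ← PadicInt.coe_sub, ← PadicInt.norm_def]
  obtain ⟨t, ht⟩ := h
  rw [ht, norm_mul, norm_pow, PadicInt.norm_p]
  exact mul_le_of_le_one_right (by positivity) (PadicInt.norm_le_one t)

lemma norm_ballPow_le (a : ℤ_[p]) (i m : ℕ) (z : ℤ_[p]) :
    ‖ballPow L a i m z‖ ≤ (((p : ℝ)⁻¹) ^ m) ^ i := by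
  unfold ballPow ballInd
  split_ifs with h
  · rw [one_mul, norm_pow]
    exact pow_le_pow_left₀ (norm_nonneg _) (norm_iotaL_sub_le h) i
  · simp

lemma pair_ballPow (a : ℤ_[p]) (i m : ℕ) (w : L[X]) :
    pair (fun n : ℕ => ballPow L a i m n) w =
      pair (fun n : ℕ => ballInd L a m n) ((shiftMul (iotaL p L a))^[i] w) := by
  rw [pair_iterate_shiftMul]
  congr 2; ext n
  rw [ballPow, iotaL_natCast_sub, mul_comm]

lemma pair_ballPow_zero {a : ℤ_[p]} {i K : ℕ} {w : L[X]} (h : (X - 1) ^ K ∣ w) (hi : i < K) :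
    pair (fun n : ℕ => ballPow L a i 0 n) w = 0 := by
  rw [← pair_sub_pow_eq_zero h (iotaL p L a) hi]
  congr 2; ext n
  rw [ballPow, iotaL_natCast_sub, ballInd_zero, one_mul]

lemma pair_ballPow_succ (a : ℤ_[p]) {i K m : ℕ} (hi : i < K) {w : L[X]} (h : Phi p L m ^ K ∣ w) :
    (p : L) * pair (fun n : ℕ => ballPow L a i (m + 1) n) w =
      pair (fun n : ℕ => ballPow L a i m n) w := by
  rw [pair_ballPow, pair_ballPow]
  exact pair_ballInd_succ a m (dvd_iterate_shiftMul_of_lt _ h hi)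

lemma sum_telescope_eq {lam c q : L} (hlam : lam = c * q) (hlam0 : lam ≠ 0) (hc : c ≠ 1)
    {x y : ℕ → L} (hx : x 0 = 0) (hy : y 0 = 0) (N : ℕ)
    (h : ∀ m < N, q * y (m + 1) - y m = c ^ (m + 1) * (q * x (m + 1) - x m)) :
    ∑ v ∈ Finset.range N, lam ^ v * (x v - x (v + 1)) =
      (1 - lam⁻¹) / (1 - c) * (q ^ N * y N - lam ^ N * c * x N) - lam ^ N * x N := by
  induction N with
  | zero => simp [hx, hy]
  | succ N ih =>
    rw [Finset.sum_range_succ, ih fun m hm => h m (by omega)]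
    have hN := h N (by omega)
    have hc1 : 1 - c ≠ 0 := sub_ne_zero.2 hc.symm
    have e1 : q ^ (N + 1) * y (N + 1) = q ^ N * y N + lam ^ N * c * (q * x (N + 1) - x N) := by
      rw [hlam, mul_pow]
      linear_combination q ^ N * hN
    have e2 : (1 - lam⁻¹) / (1 - c) * (q - lam) * c = lam - 1 := by
      have : (q - lam) * c = (1 - c) * lam := by rw [hlam]; ring
      rw [mul_assoc, this]
      field_simp
    rw [e1]
    linear_combination (-lam ^ N * x (N + 1)) * e2

variable (L) in
/-- The function `z ↦ lam ^ val (z - a) * (z - a) ^ i` on `ℤ_p`, extended by `0` at `a`. -/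
def specInt (lam : L) (a : ℤ_[p]) (i : ℕ) (z : ℤ_[p]) : L :=
  if z = a then 0 else lam ^ (z - a).valuation * (iotaL p L ((z : ℚ_[p]) - a)) ^ i

lemma pow_dvd_iff_le_valuation {x : ℤ_[p]} (hx : x ≠ 0) (m : ℕ) :
    (p : ℤ_[p]) ^ m ∣ x ↔ m ≤ x.valuation := by
  rw [← PadicInt.mem_span_pow_iff_le_valuation x hx, Ideal.mem_span_singleton]

lemma specInt_eq_sum (lam : L) (a : ℤ_[p]) (i M : ℕ) (z : ℤ_[p]) :
    specInt L lam a i z =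
      ∑ v ∈ Finset.range M, lam ^ v * (ballPow L a i v z - ballPow L a i (v + 1) z) +
        ballInd L a M z * specInt L lam a i z := by
  induction M with
  | zero => simp [ballInd_zero]
  | succ M ih =>
    rw [Finset.sum_range_succ]
    conv_lhs => rw [ih]
    rw [add_assoc]
    congr 1
    by_cases hz : z = a
    · subst hz
      simp [specInt, ballPow, ballInd]
    have hza : z - a ≠ 0 := sub_ne_zero.2 hz
    simp only [specInt, if_neg hz, ballPow, ballInd, pow_dvd_iff_le_valuation hza]
    rcases lt_trichotomy M (z - a).valuation with h | h | h
    · rw [if_pos (by omega), if_pos (by omega)]; ring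
    · rw [if_pos (by omega), if_neg (by omega), ← h]; ring
    · rw [if_neg (by omega), if_neg (by omega)]; ring

lemma norm_ballInd_mul_specInt_le {lam : L} {i : ℕ} (hlam : ‖lam‖ * ((p : ℝ)⁻¹) ^ i ≤ 1)
    (a : ℤ_[p]) (N : ℕ) (z : ℤ_[p]) :
    ‖ballInd L a N z * specInt L lam a i z‖ ≤ (‖lam‖ * ((p : ℝ)⁻¹) ^ i) ^ N := by
  by_cases hz : z = a
  · simp [specInt, hz]; positivity
  have hza : z - a ≠ 0 := sub_ne_zero.2 hz
  simp only [specInt, if_neg hz, ballInd, pow_dvd_iff_le_valuation hza]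
  split_ifs with h
  · rw [one_mul, norm_mul, norm_pow, norm_pow]
    have h1 := norm_iotaL_sub_le (L := L) ((pow_dvd_iff_le_valuation hza _).2 le_rfl)
    calc _ ≤ ‖lam‖ ^ (z - a).valuation * (((p : ℝ)⁻¹) ^ (z - a).valuation) ^ i := by gcongr
      _ = (‖lam‖ * ((p : ℝ)⁻¹) ^ i) ^ (z - a).valuation := by
        rw [mul_pow, ← pow_mul, ← pow_mul, mul_comm i]
      _ ≤ _ := pow_le_pow_of_le_one (by positivity) hlam h
  · simp; positivity

lemma norm_pair_specInt_le {K i N : ℕ} (hi : i < K) {α β : L} (hα : α ≠ 0) (hβ : β ≠ 0)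
    (hαβ : α ≠ β) {S : ℝ} {w w' : L[X]}
    (hρ : ‖α‖ * (‖β‖⁻¹ * ((p : ℝ)⁻¹) ^ (i + 1)) ≤ 1)
    (hw : (X - 1) ^ K ∣ w) (hw' : (X - 1) ^ K ∣ w') (hsol : Sol p K α β N w w')
    (hb : CoeffBound S (C (α ^ N) * w)) (hb' : CoeffBound S (C (β ^ N) * w')) (a : ℤ_[p]) :
    ‖pair (fun n : ℕ => specInt L (α * p / β) a i n) w‖ ≤
      (1 + ‖(1 - (α * (p : L) / β)⁻¹) / (1 - α / β)‖ * (1 + ‖α / β‖)) *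
        (S * (‖β‖⁻¹ * ((p : ℝ)⁻¹) ^ (i + 1)) ^ N) := by
  have hp0 : (p : L) ≠ 0 := by
    rw [← norm_ne_zero_iff, norm_natCast_p]; exact inv_ne_zero (prime_cast_pos p).ne'
  set lam := α * (p : L) / β with hlamdef
  set ρ := ‖β‖⁻¹ * ((p : ℝ)⁻¹) ^ (i + 1) with hρdef
  have hlam0 : lam ≠ 0 := div_ne_zero (mul_ne_zero hα hp0) hβ
  have hρ0 : 0 ≤ ρ := by positivity
  have hS := hb.nonneg
  have hlamn : ‖lam‖ * ((p : ℝ)⁻¹) ^ i = ‖α‖ * ρ := by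
    rw [hlamdef, hρdef, norm_div, norm_mul, norm_natCast_p, pow_succ]; ring
  set x : ℕ → L := fun m => pair (fun n : ℕ => ballPow L a i m n) w with hx
  set y : ℕ → L := fun m => pair (fun n : ℕ => ballPow L a i m n) w' with hy
  have hrec : ∀ m < N, (p : L) * y (m + 1) - y m =
      (α / β) ^ (m + 1) * ((p : L) * x (m + 1) - x m) := by
    intro m hm
    have h := pair_ballPow_succ a hi (hsol m hm)
    simp only [map_sub, pair_C_mul] at h
    have hβm : β ^ (m + 1) ≠ 0 := pow_ne_zero _ hβ
    rw [div_pow]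
    field_simp
    simp only [hx, hy]
    linear_combination -h
  have htel := sum_telescope_eq (c := α / β) (q := (p : L)) (lam := lam)
    (by rw [hlamdef]; ring) hlam0 (fun h => hαβ ((div_eq_one_iff_eq hβ).1 h))
    (pair_ballPow_zero (a := a) hw hi) (pair_ballPow_zero (a := a) hw' hi) N hrec
  have hxN : ‖lam ^ N * x N‖ ≤ S * ρ ^ N := by
    have h1 := norm_pair_le hb (by positivity) fun n : ℕ => norm_ballPow_le (L := L) a i N n
    rw [pair_C_mul] at h1
    have e : lam ^ N * x N = ((p : L) / β) ^ N * (α ^ N * x N) := by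
      rw [hlamdef, ← mul_assoc, ← mul_pow]; ring
    rw [e, norm_mul, norm_pow, norm_div, norm_natCast_p]
    calc _ ≤ ((p : ℝ)⁻¹ / ‖β‖) ^ N * (S * (((p : ℝ)⁻¹) ^ N) ^ i) := by gcongr
      _ = S * ρ ^ N := by
        rw [hρdef, ← pow_mul, mul_comm N i, pow_mul, mul_left_comm, ← mul_pow, pow_succ]
        ring
  have hyN : ‖(p : L) ^ N * y N‖ ≤ S * ρ ^ N := by
    have h1 := norm_pair_le hb' (by positivity) fun n : ℕ => norm_ballPow_le (L := L) a i N n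
    rw [pair_C_mul] at h1
    have e : (p : L) ^ N * y N = ((p : L) / β) ^ N * (β ^ N * y N) := by
      rw [← mul_assoc, ← mul_pow, div_mul_cancel₀ _ hβ]
    rw [e, norm_mul, norm_pow, norm_div, norm_natCast_p]
    calc _ ≤ ((p : ℝ)⁻¹ / ‖β‖) ^ N * (S * (((p : ℝ)⁻¹) ^ N) ^ i) := by gcongr
      _ = S * ρ ^ N := by
        rw [hρdef, ← pow_mul, mul_comm N i, pow_mul, mul_left_comm, ← mul_pow, pow_succ]
        ring
  have htail : ‖pair (fun n : ℕ => ballInd L a N n * specInt L lam a i n) w‖ ≤ S * ρ ^ N := by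
    have h1 := norm_pair_le hb (by positivity) fun n : ℕ =>
      norm_ballInd_mul_specInt_le (L := L) (lam := lam) (i := i) (hlamn ▸ hρ) a N n
    rw [pair_C_mul, hlamn, norm_mul, norm_pow, mul_pow] at h1
    have hαN : 0 < ‖α‖ ^ N := pow_pos (norm_pos_iff.2 hα) N
    refine le_of_mul_le_mul_left (h1.trans_eq ?_) hαN
    ring
  have hdec : pair (fun n : ℕ => specInt L lam a i n) w =
      ∑ v ∈ Finset.range N, lam ^ v * (x v - x (v + 1)) +
        pair (fun n : ℕ => ballInd L a N n * specInt L lam a i n) w := by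
    have e : (fun n : ℕ => specInt L lam a i n) =
        (∑ v ∈ Finset.range N, lam ^ v •
          ((fun n : ℕ => ballPow L a i v n) - fun n : ℕ => ballPow L a i (v + 1) n)) +
        fun n : ℕ => ballInd L a N n * specInt L lam a i n := by
      ext n
      simp only [Pi.add_apply, Finset.sum_apply, Pi.smul_apply, Pi.sub_apply, smul_eq_mul]
      exact specInt_eq_sum lam a i N n
    rw [e, pair_add_left, pair_sum_left]
    simp only [pair_smul_left, pair_sub_left, hx]
  rw [hdec, htel]
  set A := (1 - lam⁻¹) / (1 - α / β)
  have hT : 0 ≤ S * ρ ^ N := by positivity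
  have h2 : ‖A * ((p : L) ^ N * y N - lam ^ N * (α / β) * x N)‖ ≤
      ‖A‖ * (1 + ‖α / β‖) * (S * ρ ^ N) := by
    rw [norm_mul, mul_assoc ‖A‖]
    refine mul_le_mul_of_nonneg_left ?_ (norm_nonneg A)
    refine (norm_sub_le ((p : L) ^ N * y N) (lam ^ N * (α / β) * x N)).trans ?_
    rw [add_mul, one_mul]
    refine add_le_add hyN ?_
    rw [mul_right_comm, norm_mul, mul_comm]
    gcongr
  have h3 : ∀ u : L, ‖u‖ ≤ S * ρ ^ N →
      ‖u‖ ≤ (1 + ‖A‖ * (1 + ‖α / β‖)) * (S * ρ ^ N) := fun u hu =>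
    hu.trans (le_mul_of_one_le_left hT (le_add_of_nonneg_right (by positivity)))
  refine (IsUltrametricDist.norm_add_le_max _ _).trans (max_le ?_ (h3 _ htail))
  rw [sub_eq_add_neg]
  refine (IsUltrametricDist.norm_add_le_max _ _).trans
    (max_le ?_ (by rw [norm_neg]; exact h3 _ hxN))
  refine h2.trans ?_
  gcongr
  linarith

lemma X_sub_one_pow_sub_Ypol_bound (v : ℕ) :
    CoeffBound ((p : ℝ)⁻¹) ((X - 1) ^ p ^ v - Ypol p L v) := by
  set D : ℤ[X] := (X - 1) ^ p ^ v - (X ^ p ^ v - 1) with hD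
  have hmap : D.map (Int.castRingHom (ZMod p)) = 0 := by
    simp only [hD, Polynomial.map_sub, Polynomial.map_pow, map_X, Polynomial.map_one]
    rw [sub_pow_char_pow, one_pow, sub_self]
  have hL : (X - 1) ^ p ^ v - Ypol p L v = D.map (Int.castRingHom L) := by
    simp [hD, Ypol]
  intro n
  have hn : (p : ℤ) ∣ D.coeff n := by
    have := congrArg (fun q => q.coeff n) hmap
    simpa [coeff_map, ZMod.intCast_zmod_eq_zero_iff_dvd] using this
  obtain ⟨t, ht⟩ := hn
  rw [hL, coeff_map, ht]
  simp only [eq_intCast, Int.cast_mul, Int.cast_natCast, norm_mul, norm_natCast_p]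
  exact mul_le_of_le_one_right (by positivity) (IsUltrametricDist.norm_intCast_le_one L t)

lemma modBound_X_sub_one_pow (K v n : ℕ) :
    ModBound p K v (((p : ℝ)⁻¹) ^ (n / p ^ v - K)) ((X - 1 : L[X]) ^ n) := by
  have hinv : (p : ℝ)⁻¹ ≤ 1 := inv_le_one_of_one_le₀ (one_lt_prime_cast p).le
  set t := n / p ^ v
  have hone : CoeffBound 1 (X - 1 : L[X]) := by
    simpa using CoeffBound.X_pow_sub_one (L := L) 1
  set u : L[X] := (X - 1) ^ p ^ v - Ypol p L v with hu
  have hub : CoeffBound ((p : ℝ)⁻¹) u := X_sub_one_pow_sub_Ypol_bound v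
  have e : (X - 1 : L[X]) ^ n = (Ypol p L v + u) ^ t * (X - 1) ^ (n % p ^ v) := by
    rw [hu, add_sub_cancel, ← pow_mul, ← pow_add, Nat.div_add_mod]
  rw [e, ← mul_one (((p : ℝ)⁻¹) ^ (t - K))]
  refine ModBound.mul ?_ ((hone.pow_of_one _).modBound K v)
  rw [add_pow]
  refine ModBound.sum (by positivity) _ _ fun j hj => ?_
  have hnat : CoeffBound 1 ((t.choose j : ℕ) : L[X]) := by
    rw [← map_natCast (C : L →+* L[X])]
    intro m
    refine (CoeffBound.const _ m).trans (IsUltrametricDist.norm_natCast_le_one L _)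
  by_cases hjK : j < K
  · refine CoeffBound.modBound ?_ K v
    have h1 := ((((Ypol_bound (p := p) (L := L) v).pow_of_one j).mul (hub.pow (t - j))).mul hnat)
    refine h1.mono ?_
    rw [one_mul, mul_one]
    exact pow_le_pow_of_le_one (by positivity) hinv (by omega)
  · refine ((CoeffBound.zero (by positivity)).modBound K v).congr ?_
    rw [sub_zero, mul_assoc]
    exact (pow_dvd_pow _ (by omega)).trans (dvd_mul_right _ _)

lemma pair_ballPow_eq_zero (a : ℤ_[p]) {i K m : ℕ} (hi : i < K) {w : L[X]}
    (h : Ypol p L m ^ K ∣ w) : pair (fun n : ℕ => ballPow L a i m n) w = 0 := by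
  rw [pair_ballPow]
  obtain ⟨q, hq⟩ := dvd_iterate_shiftMul_of_lt (iotaL p L a) h hi
  rw [hq, Ypol, sub_mul, one_mul, map_sub, pair_X_pow_mul, sub_eq_zero]
  congr 2; ext n
  have := ballInd_add_pow_mul (L := L) a m n 1
  push_cast
  rwa [Nat.cast_one, mul_one] at this

lemma norm_pair_ballPow_le (a : ℤ_[p]) {i K m : ℕ} (hi : i < K) {w : L[X]} {S : ℝ}
    (h : ModBound p K m S w) :
    ‖pair (fun n : ℕ => ballPow L a i m n) w‖ ≤ S * (((p : ℝ)⁻¹) ^ m) ^ i := by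
  obtain ⟨R, hR, hd⟩ := h
  have h0 := pair_ballPow_eq_zero a hi hd
  rw [map_sub, sub_eq_zero] at h0
  rw [h0]
  exact norm_pair_le hR (by positivity) fun n => norm_ballPow_le a i m n

lemma tendsto_rpow_mul_inv_pow {r : ℝ} {K : ℕ} (hrK : r ≤ K) (p : ℕ) [Fact p.Prime] :
    Tendsto (fun t : ℕ => ((t : ℝ) + 1) ^ r * ((p : ℝ)⁻¹) ^ t) atTop (𝓝 0) := by
  have hp := prime_cast_pos p
  have h1 : |(p : ℝ)⁻¹| < 1 := by
    rw [abs_of_pos (inv_pos.2 hp)]; exact inv_lt_one_of_one_lt₀ (one_lt_prime_cast p)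
  have h := ((tendsto_add_atTop_iff_nat 1).2
    (tendsto_pow_const_mul_const_pow_of_abs_lt_one K h1)).mul_const (p : ℝ)
  rw [zero_mul] at h
  refine squeeze_zero (fun t => by positivity) (fun t => ?_) h
  rw [pow_succ, ← mul_assoc, inv_mul_cancel_right₀ hp.ne']
  gcongr
  rw [← Real.rpow_natCast]
  push_cast
  exact Real.rpow_le_rpow_of_exponent_le (by linarith [(Nat.cast_nonneg t : (0:ℝ) ≤ t)]) hrK

lemma exists_rpow_mul_inv_pow_le {r : ℝ} {K : ℕ} (hrK : r ≤ K) (p : ℕ) [Fact p.Prime] :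
    ∃ B : ℝ, 0 ≤ B ∧ ∀ t : ℕ, ((t : ℝ) + 1) ^ r * ((p : ℝ)⁻¹) ^ t ≤ B := by
  obtain ⟨B, hB⟩ := (tendsto_rpow_mul_inv_pow hrK p).bddAbove_range
  have hB' : ∀ t : ℕ, ((t : ℝ) + 1) ^ r * ((p : ℝ)⁻¹) ^ t ≤ B := fun t => hB ⟨t, rfl⟩
  exact ⟨B, le_trans (by positivity) (hB' 0), hB'⟩

lemma inv_pow_sub_le (p : ℕ) [Fact p.Prime] (t K : ℕ) :
    ((p : ℝ)⁻¹) ^ (t - K) ≤ (p : ℝ) ^ K * ((p : ℝ)⁻¹) ^ t := by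
  have hp := prime_cast_pos p
  have h1 : (p : ℝ) ^ K * ((p : ℝ)⁻¹) ^ K = 1 := by rw [← mul_pow, mul_inv_cancel₀ hp.ne', one_pow]
  calc ((p : ℝ)⁻¹) ^ (t - K) = (p : ℝ) ^ K * ((p : ℝ)⁻¹) ^ (t - K + K) := by
        rw [pow_add, mul_left_comm, h1, mul_one]
    _ ≤ _ := by
        gcongr ?_ * ?_
        exact pow_le_pow_of_le_one (by positivity)
          (inv_le_one_of_one_le₀ (one_lt_prime_cast p).le) (by omega)

lemma add_one_le_div_add_one_mul (n : ℕ) {q : ℕ} (hq : 0 < q) :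
    (n : ℝ) + 1 ≤ (((n / q : ℕ) : ℝ) + 1) * q := by
  have := Nat.lt_div_mul_add hq (a := n)
  have h2 : n + 1 ≤ (n / q + 1) * q := by rw [add_mul, one_mul]; omega
  exact_mod_cast h2

variable (p) in
/-- The normalized Mahler coefficients of order `r` of `f` are bounded. -/
def MahlerBdd (r : ℝ) (f : ℤ_[p] → L) : Prop :=
  ∃ B : ℝ, ∀ n : ℕ, ((n : ℝ) + 1) ^ r * ‖mahlerCoeff p L f n‖ ≤ B

lemma mahlerCoeff_add (f g : ℤ_[p] → L) (n : ℕ) :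
    mahlerCoeff p L (f + g) n = mahlerCoeff p L f n + mahlerCoeff p L g n := by
  simp [mahlerCoeff, mul_add, Finset.sum_add_distrib]

lemma mahlerCoeff_smul (c : L) (f : ℤ_[p] → L) (n : ℕ) :
    mahlerCoeff p L (c • f) n = c * mahlerCoeff p L f n := by
  simp only [mahlerCoeff, Pi.smul_apply, smul_eq_mul, Finset.mul_sum]
  exact Finset.sum_congr rfl fun i _ => by ring

lemma MahlerBdd.add {r : ℝ} {f g : ℤ_[p] → L} (hf : MahlerBdd p r f) (hg : MahlerBdd p r g) :
    MahlerBdd p r (f + g) := by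
  obtain ⟨A, hA⟩ := hf
  obtain ⟨B, hB⟩ := hg
  refine ⟨A + B, fun n => ?_⟩
  rw [mahlerCoeff_add]
  have := norm_add_le (mahlerCoeff p L f n) (mahlerCoeff p L g n)
  calc _ ≤ ((n : ℝ) + 1) ^ r * (‖mahlerCoeff p L f n‖ + ‖mahlerCoeff p L g n‖) := by gcongr
    _ ≤ _ := by rw [mul_add]; exact add_le_add (hA n) (hB n)

lemma MahlerBdd.smul {r : ℝ} {f : ℤ_[p] → L} (hf : MahlerBdd p r f) (c : L) :
    MahlerBdd p r (c • f) := by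
  obtain ⟨A, hA⟩ := hf
  refine ⟨‖c‖ * A, fun n => ?_⟩
  rw [mahlerCoeff_smul, norm_mul, mul_left_comm]
  exact mul_le_mul_of_nonneg_left (hA n) (norm_nonneg c)

lemma mahlerBdd_zero (r : ℝ) : MahlerBdd p r (0 : ℤ_[p] → L) :=
  ⟨0, fun n => by simp [mahlerCoeff]⟩

lemma mahlerBdd_of_eventually_zero {r : ℝ} {f : ℤ_[p] → L} (M : ℕ)
    (h : ∀ n ≥ M, mahlerCoeff p L f n = 0) : MahlerBdd p r f := by
  refine ⟨∑ n ∈ Finset.range M, ((n : ℝ) + 1) ^ r * ‖mahlerCoeff p L f n‖, fun n => ?_⟩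
  by_cases hn : n < M
  · exact Finset.single_le_sum (f := fun n : ℕ => ((n : ℝ) + 1) ^ r * ‖mahlerCoeff p L f n‖)
      (fun i _ => by positivity) (Finset.mem_range.2 hn)
  · rw [h n (by omega), norm_zero, mul_zero]
    exact Finset.sum_nonneg fun i _ => by positivity

lemma mahlerBdd_sub_pow (r : ℝ) (a : ℚ_[p]) (j : ℕ) :
    MahlerBdd p r (fun z : ℤ_[p] => iotaL p L ((z : ℚ_[p]) - a) ^ j) := by
  refine mahlerBdd_of_eventually_zero (j + 1) fun n hn => ?_
  rw [← pair_X_sub_one_pow]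
  rw [← pair_sub_pow_eq_zero (dvd_refl ((X - 1 : L[X]) ^ n)) (iotaL p L a) hn]
  congr 2; ext i
  simp [iotaL]

lemma mahlerBdd_specInt {r : ℝ} {K i : ℕ} (hr : 0 ≤ r) (hrK : r ≤ K) (hi : i < K) {lam : L}
    (hlam : ‖lam‖ * ((p : ℝ)⁻¹) ^ i ≤ (p : ℝ) ^ (-r)) (a : ℤ_[p]) :
    MahlerBdd p r (specInt L lam a i) := by
  have hp := prime_cast_pos p
  have hp1 := one_lt_prime_cast p
  obtain ⟨B, hB0, hB⟩ := exists_rpow_mul_inv_pow_le hrK p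
  have hpr1 : (p : ℝ) ^ (-r) ≤ 1 := Real.rpow_le_one_of_one_le_of_nonpos hp1.le (by linarith)
  set D : ℝ := (p : ℝ) ^ r * ((p : ℝ) ^ K * B) with hD
  have hrv : ∀ v : ℕ, ((p : ℝ) ^ (-r)) ^ v = (((p : ℝ) ^ v) ^ r)⁻¹ := fun v => by
    rw [← Real.rpow_natCast, ← Real.rpow_mul hp.le, ← Real.rpow_natCast, ← Real.rpow_mul hp.le,
      ← Real.rpow_neg hp.le]
    ring_nf
  refine ⟨max 1 D, fun n => ?_⟩
  obtain ⟨M, hM⟩ := pow_unbounded_of_one_lt ((n : ℝ) + 1) hp1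
  have hn0 : (0 : ℝ) ≤ (n : ℝ) + 1 := by positivity
  rw [← pair_X_sub_one_pow]
  have e : (fun n : ℕ => specInt L lam a i n) =
      (∑ v ∈ Finset.range M, lam ^ v •
        ((fun n : ℕ => ballPow L a i v n) - fun n : ℕ => ballPow L a i (v + 1) n)) +
      fun n : ℕ => ballInd L a M n * specInt L lam a i n := by
    ext n
    simp only [Pi.add_apply, Finset.sum_apply, Pi.smul_apply, Pi.sub_apply, smul_eq_mul]
    exact specInt_eq_sum lam a i M n
  have hone : CoeffBound 1 (X - 1 : L[X]) := by
    simpa using CoeffBound.X_pow_sub_one (L := L) 1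
  have htail : ((n : ℝ) + 1) ^ r *
      ‖pair (fun n : ℕ => ballInd L a M n * specInt L lam a i n) ((X - 1) ^ n)‖ ≤ 1 := by
    have h1 := norm_pair_le (hone.pow_of_one n) (by positivity) fun n : ℕ =>
      norm_ballInd_mul_specInt_le (hlam.trans hpr1) a M n
    rw [one_mul] at h1
    have h2 : (‖lam‖ * ((p : ℝ)⁻¹) ^ i) ^ M ≤ (((p : ℝ) ^ M) ^ r)⁻¹ := by
      rw [← hrv]; gcongr
    have h3 : ((n : ℝ) + 1) ^ r ≤ ((p : ℝ) ^ M) ^ r := Real.rpow_le_rpow hn0 hM.le hr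
    calc _ ≤ ((p : ℝ) ^ M) ^ r * (((p : ℝ) ^ M) ^ r)⁻¹ := by
            gcongr; exact h1.trans h2
      _ = 1 := mul_inv_cancel₀ (by positivity)
  have hlev : ∀ v m : ℕ, (m = v ∨ m = v + 1) → ((n : ℝ) + 1) ^ r *
      (‖lam‖ ^ v * ‖pair (fun n : ℕ => ballPow L a i m n) ((X - 1) ^ n)‖) ≤ D := by
    intro v m hm
    set t := n / p ^ (v + 1) with ht
    have hmb : ‖pair (fun n : ℕ => ballPow L a i m n) ((X - 1) ^ n)‖ ≤
        (p : ℝ) ^ K * ((p : ℝ)⁻¹) ^ t * (((p : ℝ)⁻¹) ^ v) ^ i := by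
      refine (norm_pair_ballPow_le a hi (modBound_X_sub_one_pow K m n)).trans ?_
      refine mul_le_mul ((inv_pow_sub_le p _ K).trans ?_) ?_ (by positivity) (by positivity)
      · gcongr ?_ * ?_
        refine pow_le_pow_of_le_one (by positivity) (inv_le_one_of_one_le₀ hp1.le) ?_
        rw [ht]
        refine Nat.div_le_div_left ?_ (pow_pos (Fact.out : p.Prime).pos m)
        exact Nat.pow_le_pow_right (Fact.out : p.Prime).pos (by omega)
      · gcongr ?_ ^ i
        exact pow_le_pow_of_le_one (by positivity) (inv_le_one_of_one_le₀ hp1.le) (by omega)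
    have h1 : ‖lam‖ ^ v * ‖pair (fun n : ℕ => ballPow L a i m n) ((X - 1) ^ n)‖ ≤
        (((p : ℝ) ^ v) ^ r)⁻¹ * ((p : ℝ) ^ K * ((p : ℝ)⁻¹) ^ t) := by
      calc _ ≤ ‖lam‖ ^ v * ((p : ℝ) ^ K * ((p : ℝ)⁻¹) ^ t * (((p : ℝ)⁻¹) ^ v) ^ i) := by gcongr
        _ = (‖lam‖ * ((p : ℝ)⁻¹) ^ i) ^ v * ((p : ℝ) ^ K * ((p : ℝ)⁻¹) ^ t) := by
          rw [mul_pow, ← pow_mul, ← pow_mul, mul_comm v i]; ring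
        _ ≤ _ := by rw [← hrv]; gcongr
    have h2 : ((n : ℝ) + 1) ^ r ≤ ((t : ℝ) + 1) ^ r * ((p : ℝ) ^ v) ^ r * (p : ℝ) ^ r := by
      rw [← Real.mul_rpow (by positivity) (by positivity),
        ← Real.mul_rpow (by positivity) (by positivity)]
      refine Real.rpow_le_rpow hn0 ?_ hr
      have := add_one_le_div_add_one_mul n (pow_pos (Fact.out : p.Prime).pos (v + 1))
      push_cast at this
      rw [mul_assoc, ← pow_succ]
      exact this
    calc _ ≤ (((t : ℝ) + 1) ^ r * ((p : ℝ) ^ v) ^ r * (p : ℝ) ^ r) *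
          ((((p : ℝ) ^ v) ^ r)⁻¹ * ((p : ℝ) ^ K * ((p : ℝ)⁻¹) ^ t)) := by gcongr
      _ = (p : ℝ) ^ r * ((p : ℝ) ^ K * (((t : ℝ) + 1) ^ r * ((p : ℝ)⁻¹) ^ t)) := by
        have : ((p : ℝ) ^ v) ^ r ≠ 0 := by positivity
        field_simp
      _ ≤ D := by rw [hD]; gcongr; exact hB t
  have hD0 : 0 ≤ D := by positivity
  have hpos : (0 : ℝ) < ((n : ℝ) + 1) ^ r := by positivity
  have hsum : ‖∑ v ∈ Finset.range M, pair (lam ^ v •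
      ((fun n : ℕ => ballPow L a i v n) - fun n : ℕ => ballPow L a i (v + 1) n))
      ((X - 1) ^ n)‖ ≤ D / ((n : ℝ) + 1) ^ r := by
    refine IsUltrametricDist.norm_sum_le_of_forall_le_of_nonneg (by positivity) fun v _ => ?_
    rw [pair_smul_left, pair_sub_left, mul_sub, sub_eq_add_neg]
    refine (IsUltrametricDist.norm_add_le_max _ _).trans (max_le ?_ ?_)
    · rw [le_div_iff₀' hpos, norm_mul, norm_pow]
      exact hlev v v (Or.inl rfl)
    · rw [le_div_iff₀' hpos, norm_neg, norm_mul, norm_pow]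
      exact hlev v (v + 1) (Or.inr rfl)
  rw [e, pair_add_left, pair_sum_left, ← le_div_iff₀' hpos]
  refine (IsUltrametricDist.norm_add_le_max _ _).trans (max_le ?_ ?_)
  · exact hsum.trans (by gcongr; exact le_max_right _ _)
  · refine le_trans ?_ (div_le_div_of_nonneg_right (le_max_left 1 D) hpos.le)
    rwa [le_div_iff₀' hpos]

lemma binomQ_eq_choose (z : ℤ_[p]) (n : ℕ) : binomQ p z n = (Ring.choose z n : ℤ_[p]) := by
  have hn : (n.factorial : ℚ_[p]) ≠ 0 := by exact_mod_cast n.factorial_ne_zero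
  rw [binomQ, div_eq_iff hn]
  have h := Ring.descPochhammer_eq_factorial_smul_choose z n
  rw [← aeval_eq_smeval, aeval_def, ← eval_map, descPochhammer_map,
    descPochhammer_eval_eq_prod_range] at h
  have h2 := congrArg PadicInt.Coe.ringHom h
  rw [map_prod, nsmul_eq_mul, map_mul, map_natCast, mul_comm] at h2
  refine Eq.trans (Finset.prod_congr rfl fun i _ => ?_) h2
  rw [map_sub, map_natCast]
  rfl

lemma norm_iotaL_binomQ_le (z : ℤ_[p]) (n : ℕ) : ‖iotaL p L (binomQ p z n)‖ ≤ 1 := by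
  rw [norm_iotaL, binomQ_eq_choose]; exact PadicInt.norm_le_one _

lemma iotaL_binomQ_natCast (i n : ℕ) : iotaL p L (binomQ p (i : ℤ_[p]) n) = (i.choose n : L) := by
  rw [binomQ_eq_choose, Ring.choose_natCast]; simp [iotaL]

lemma pair_coeff_modByMonic (P : L[X]) (m : ℕ) (w : L[X]) :
    pair (fun i : ℕ => (X ^ i %ₘ P).coeff m) w = (w %ₘ P).coeff m := by
  induction w using Polynomial.induction_on' with
  | add v w hv hw => rw [map_add, add_modByMonic, coeff_add, hv, hw]
  | monomial n c =>
    rw [pair_monomial, ← C_mul_X_pow_eq_monomial, ← smul_eq_C_mul, smul_modByMonic, coeff_smul,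
      smul_eq_mul]

variable (p L) in
/-- The function on `ℤ_p` whose Mahler coefficients are the `m`-th coefficients of the
reductions of the powers of `X - 1` modulo `Ypol p L d ^ K`. -/
def testFun (K d m : ℕ) (z : ℤ_[p]) : L :=
  ∑' n : ℕ, ((X - 1 : L[X]) ^ n %ₘ Ypol p L d ^ K).coeff m * iotaL p L (binomQ p z n)

lemma tendsto_nat_div_atTop {q : ℕ} (hq : 0 < q) : Tendsto (fun n : ℕ => n / q) atTop atTop := by
  refine tendsto_atTop.2 fun b => ?_
  filter_upwards [eventually_ge_atTop (b * q)] with n hn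
  exact (Nat.le_div_iff_mul_le hq).2 hn

lemma tendsto_rpow_mul_coeff {r : ℝ} (hr : 0 ≤ r) {K : ℕ} (hrK : r ≤ K) (d m : ℕ) :
    Tendsto (fun n : ℕ => ((n : ℝ) + 1) ^ r *
      ‖((X - 1 : L[X]) ^ n %ₘ Ypol p L d ^ K).coeff m‖) atTop (𝓝 0) := by
  have hq := pow_pos (Fact.out : p.Prime).pos d
  have h := ((tendsto_rpow_mul_inv_pow hrK p).comp (tendsto_nat_div_atTop hq)).const_mul
    ((((p : ℝ) ^ d) ^ r) * (p : ℝ) ^ K)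
  rw [mul_zero] at h
  refine squeeze_zero (fun n => by positivity) (fun n => ?_) h
  have h1 := (modBound_X_sub_one_pow (p := p) (L := L) K d n).modByMonic m
  have h2 : ((n : ℝ) + 1) ^ r ≤ (((n / p ^ d : ℕ) : ℝ) + 1) ^ r * ((p : ℝ) ^ d) ^ r := by
    rw [← Real.mul_rpow (by positivity) (by positivity)]
    refine Real.rpow_le_rpow (by positivity) ?_ hr
    have := add_one_le_div_add_one_mul n hq
    push_cast at this ⊢
    exact this
  have h3 := h1.trans (inv_pow_sub_le p _ K)
  calc _ ≤ ((((n / p ^ d : ℕ) : ℝ) + 1) ^ r * ((p : ℝ) ^ d) ^ r) *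
        ((p : ℝ) ^ K * ((p : ℝ)⁻¹) ^ (n / p ^ d)) := by gcongr
    _ = _ := by simp only [Function.comp_apply]; ring

lemma tendsto_coeff_X_sub_one_pow (K d m : ℕ) :
    Tendsto (fun n : ℕ => ((X - 1 : L[X]) ^ n %ₘ Ypol p L d ^ K).coeff m) atTop (𝓝 0) := by
  rw [tendsto_zero_iff_norm_tendsto_zero]
  simpa using tendsto_rpow_mul_coeff (p := p) (L := L) le_rfl (Nat.cast_nonneg K) d m

lemma hasSum_testFun [FiniteDimensional ℚ_[p] L] (K d m : ℕ) (z : ℤ_[p]) :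
    HasSum (fun n : ℕ => ((X - 1 : L[X]) ^ n %ₘ Ypol p L d ^ K).coeff m *
      iotaL p L (binomQ p z n)) (testFun p L K d m z) := by
  have : CompleteSpace L := FiniteDimensional.complete ℚ_[p] L
  refine (NonarchimedeanAddGroup.summable_of_tendsto_cofinite_zero ?_).hasSum
  rw [Nat.cofinite_eq_atTop]
  refine squeeze_zero_norm (fun n => ?_)
    (tendsto_zero_iff_norm_tendsto_zero.1 (tendsto_coeff_X_sub_one_pow (p := p) (L := L) K d m))
  rw [norm_mul]
  exact mul_le_of_le_one_right (norm_nonneg _) (norm_iotaL_binomQ_le z n)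

lemma testFun_natCast (K d m i : ℕ) :
    testFun p L K d m i = (X ^ i %ₘ Ypol p L d ^ K).coeff m := by
  have e : (X : L[X]) ^ i = ∑ n ∈ Finset.range (i + 1), (i.choose n : L) • (X - 1) ^ n := by
    conv_lhs => rw [← sub_add_cancel (X : L[X]) 1, add_pow]
    refine Finset.sum_congr rfl fun n _ => ?_
    rw [one_pow, mul_one, smul_eq_C_mul, map_natCast, mul_comm]
  have e2 : (X : L[X]) ^ i %ₘ Ypol p L d ^ K =
      ∑ n ∈ Finset.range (i + 1), (i.choose n : L) • ((X - 1) ^ n %ₘ Ypol p L d ^ K) := by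
    have := congrArg (modByMonicHom (Ypol p L d ^ K)) e
    rw [map_sum] at this
    simpa only [map_smul, modByMonicHom_apply] using this
  rw [testFun, tsum_eq_sum (s := Finset.range (i + 1)), e2, finsetSum_coeff]
  · refine Finset.sum_congr rfl fun n _ => ?_
    rw [iotaL_binomQ_natCast, coeff_smul, smul_eq_mul, mul_comm]
  · intro n hn
    rw [iotaL_binomQ_natCast, Nat.choose_eq_zero_of_lt (by simpa using hn), Nat.cast_zero,
      mul_zero]

lemma pair_testFun (K d m : ℕ) (w : L[X]) :
    pair (fun i : ℕ => testFun p L K d m i) w = (w %ₘ Ypol p L d ^ K).coeff m := by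
  simp only [testFun_natCast]
  exact pair_coeff_modByMonic _ m w

lemma mahlerCoeff_testFun (K d m n : ℕ) :
    mahlerCoeff p L (testFun p L K d m) n = ((X - 1 : L[X]) ^ n %ₘ Ypol p L d ^ K).coeff m := by
  rw [← pair_X_sub_one_pow, pair_testFun]

lemma isCr_testFun [FiniteDimensional ℚ_[p] L] {r : ℝ} (hr : 0 ≤ r) {K : ℕ} (hrK : r ≤ K)
    (d m : ℕ) : IsCr p L r (testFun p L K d m) := by
  constructor
  · refine squeeze_zero (fun n => by positivity) (fun n => ?_)
      (tendsto_rpow_mul_coeff (p := p) (L := L) hr hrK d m)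
    rw [mahlerCoeff_testFun]
    gcongr
    linarith
  · intro z
    simp only [mahlerCoeff_testFun]
    exact hasSum_testFun K d m z

lemma mahlerBdd_testFun {r : ℝ} (hr : 0 ≤ r) {K : ℕ} (hrK : r ≤ K)
    (d m : ℕ) : MahlerBdd p r (testFun p L K d m) := by
  obtain ⟨B, hB⟩ := (tendsto_rpow_mul_coeff (p := p) (L := L) hr hrK d m).bddAbove_range
  exact ⟨B, fun n => by rw [mahlerCoeff_testFun]; exact hB ⟨n, rfl⟩⟩

/-- The function on `ℚ_p` supported on `pℤ_p` and given there by `p z ↦ f z`. -/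
def extendZero (f : ℤ_[p] → L) (x : ℚ_[p]) : L :=
  if h : ∃ z : ℤ_[p], (p : ℚ_[p]) * z = x then f h.choose else 0

lemma extendZero_mul (f : ℤ_[p] → L) (z : ℤ_[p]) : extendZero f ((p : ℚ_[p]) * z) = f z := by
  have hp : (p : ℚ_[p]) ≠ 0 := by exact_mod_cast (Fact.out : p.Prime).ne_zero
  have h : ∃ y : ℤ_[p], (p : ℚ_[p]) * y = p * z := ⟨z, rfl⟩
  rw [extendZero, dif_pos h]
  congr 1
  exact PadicInt.ext (mul_left_cancel₀ hp h.choose_spec)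

lemma extendZero_inv (f : ℤ_[p] → L) {z : ℤ_[p]} (hz : z ≠ 0) :
    extendZero f ((z : ℚ_[p])⁻¹) = 0 := by
  rw [extendZero, dif_neg]
  rintro ⟨y, hy⟩
  have hz' : (z : ℚ_[p]) ≠ 0 := by simpa using hz
  have h1 : (p : ℚ_[p]) * y * z = 1 := by rw [hy, inv_mul_cancel₀ hz']
  have h2 := congrArg norm h1
  rw [norm_mul, norm_mul, Padic.norm_p, norm_one] at h2
  have h3 : ‖(y : ℚ_[p])‖ * ‖(z : ℚ_[p])‖ ≤ 1 :=
    mul_le_one₀ (PadicInt.norm_le_one y) (norm_nonneg _) (PadicInt.norm_le_one z)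
  have h4 : (p : ℝ)⁻¹ < 1 := inv_lt_one_of_one_lt₀ (one_lt_prime_cast p)
  have h5 : (p : ℝ)⁻¹ * (‖(y : ℚ_[p])‖ * ‖(z : ℚ_[p])‖) ≤ (p : ℝ)⁻¹ :=
    mul_le_of_le_one_right (by positivity) h3
  rw [← mul_assoc] at h5
  linarith

lemma isCr_zero (r : ℝ) : IsCr p L r (0 : ℤ_[p] → L) := by
  have h : ∀ n, mahlerCoeff p L (0 : ℤ_[p] → L) n = 0 := fun n => by simp [mahlerCoeff]
  exact ⟨by simp [h], fun z => by simp [h]⟩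

lemma memB_extendZero {k : ℕ} {α β : L} {f : ℤ_[p] → L} (hf : IsCr p L (valL p L α) f) :
    MemB p L k α β (extendZero f) := by
  refine ⟨?_, 0, isCr_zero _, fun z hz => ?_⟩
  · simpa only [extendZero_mul] using hf
  · rw [extendZero_inv f hz, mul_zero, Pi.zero_apply]

variable (p) in
/-- The numerical hypotheses on `(α, β)`, in terms of `K = k - 1` and `r = val α`. -/
structure Data (K : ℕ) (r : ℝ) (α β : L) : Prop where
  ne_zero : α ≠ 0
  ne_zero' : β ≠ 0
  ne : α ≠ β
  pos : 0 < r
  lt : r < K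
  norm_inv : ‖α‖⁻¹ = (p : ℝ) ^ r
  norm_lt_one : ‖α‖ < 1
  norm_lt_one' : ‖β‖ < 1
  norm_mul_norm : ‖α‖ * ‖β‖ = ((p : ℝ)⁻¹) ^ K

lemma hyps_data {k : ℕ} {α β : L} (h : Hyps p L k α β) :
    Data p (k - 1) (valL p L α) α β := by
  obtain ⟨hk, hne, hα, hβ, hsum, -⟩ := h
  have hp := prime_cast_pos p
  have hp1 := one_lt_prime_cast p
  have ne0 : ∀ x : L, 0 < valL p L x → x ≠ 0 := by
    rintro x hx rfl
    simp [valL] at hx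
  have hinv : ∀ x : L, 0 < valL p L x → ‖x‖⁻¹ = (p : ℝ) ^ valL p L x := by
    intro x hx
    rw [valL, Real.rpow_neg hp.le, Real.rpow_logb hp hp1.ne' (norm_pos_iff.2 (ne0 x hx))]
  have hlt : ∀ x : L, 0 < valL p L x → ‖x‖ < 1 := by
    intro x hx
    have h1 : 1 < ‖x‖⁻¹ := by rw [hinv x hx]; exact Real.one_lt_rpow hp1 hx
    exact (one_lt_inv₀ (norm_pos_iff.2 (ne0 x hx))).1 h1
  have hk1 : ((k - 1 : ℕ) : ℝ) = (k : ℝ) - 1 := by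
    rw [Nat.cast_sub (by omega), Nat.cast_one]
  refine ⟨ne0 α hα, ne0 β hβ, hne, hα, by linarith, hinv α hα, hlt α hα, hlt β hβ, ?_⟩
  rw [← inv_inj, mul_inv, hinv α hα, hinv β hβ, ← Real.rpow_add hp, hsum, ← hk1,
    Real.rpow_natCast, inv_pow, inv_inv]

variable (p) in
/-- The function `f` has bounded Mahler coefficients of order `r` and is asymptotically
annihilated by the solutions of level `N`, as `N` grows. -/
def Negl (K : ℕ) (r : ℝ) (α β : L) (f : ℤ_[p] → L) : Prop :=
  MahlerBdd p r f ∧ ∀ δ > 0, ∃ N₀ : ℕ, ∀ N ≥ N₀, ∀ (S : ℝ) (w w' : L[X]),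
    (X - 1) ^ K ∣ w → (X - 1) ^ K ∣ w' → Sol p K α β N w w' →
    CoeffBound S (C (α ^ N) * w) → CoeffBound S (C (β ^ N) * w') →
    ‖pair (fun i : ℕ => f i) w‖ ≤ δ * S

namespace Negl

variable {K : ℕ} {r : ℝ} {α β : L} {f g : ℤ_[p] → L}

lemma zero : Negl p K r α β (0 : ℤ_[p] → L) := by
  refine ⟨mahlerBdd_zero r, fun δ hδ => ⟨0, fun N _ S w w' _ _ _ h _ => ?_⟩⟩
  have : (fun i : ℕ => (0 : ℤ_[p] → L) i) = 0 := rfl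
  rw [this, pair_zero_left, norm_zero]
  exact mul_nonneg hδ.le h.nonneg

lemma add (hf : Negl p K r α β f) (hg : Negl p K r α β g) : Negl p K r α β (f + g) := by
  refine ⟨hf.1.add hg.1, fun δ hδ => ?_⟩
  obtain ⟨N₁, h₁⟩ := hf.2 δ hδ
  obtain ⟨N₂, h₂⟩ := hg.2 δ hδ
  refine ⟨max N₁ N₂, fun N hN S w w' hw hw' hs hb hb' => ?_⟩
  have e : (fun i : ℕ => (f + g) i) = (fun i : ℕ => f i) + fun i : ℕ => g i := rfl
  rw [e, pair_add_left]
  exact (IsUltrametricDist.norm_add_le_max _ _).trans (max_le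
    (h₁ N ((le_max_left _ _).trans hN) S w w' hw hw' hs hb hb')
    (h₂ N ((le_max_right _ _).trans hN) S w w' hw hw' hs hb hb'))

lemma smul (c : L) (hf : Negl p K r α β f) : Negl p K r α β (c • f) := by
  refine ⟨hf.1.smul c, fun δ hδ => ?_⟩
  have hc : 0 < ‖c‖ + 1 := by positivity
  obtain ⟨N₁, h₁⟩ := hf.2 (δ / (‖c‖ + 1)) (by positivity)
  refine ⟨N₁, fun N hN S w w' hw hw' hs hb hb' => ?_⟩
  have e : (fun i : ℕ => (c • f) i) = c • fun i : ℕ => f i := rfl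
  rw [e, pair_smul_left, norm_mul]
  have hS := hb.nonneg
  have h2 := h₁ N hN S w w' hw hw' hs hb hb'
  calc _ ≤ (‖c‖ + 1) * (δ / (‖c‖ + 1) * S) := by gcongr; linarith
    _ = δ * S := by field_simp

lemma sub_pow (a : ℚ_[p]) {j : ℕ} (hj : j < K) :
    Negl p K r α β (fun z : ℤ_[p] => iotaL p L ((z : ℚ_[p]) - a) ^ j) := by
  refine ⟨mahlerBdd_sub_pow r a j, fun δ hδ => ⟨0, fun N _ S w w' hw _ _ hb _ => ?_⟩⟩
  have e : (fun i : ℕ => iotaL p L (((i : ℤ_[p]) : ℚ_[p]) - a) ^ j) =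
      fun i : ℕ => ((i : L) - iotaL p L a) ^ j := by
    ext i; simp [iotaL]
  rw [e, pair_sub_pow_eq_zero hw _ hj, norm_zero]
  exact mul_nonneg hδ.le hb.nonneg

lemma specInt (h : Data p K r α β) {i j : ℕ} (hij : i + j + 1 = K) (hj : (j : ℝ) < r)
    (a : ℤ_[p]) : Negl p K r α β (specInt L (α * p / β) a i) := by
  have hp := prime_cast_pos p
  have hp1 := one_lt_prime_cast p
  have hα0 := norm_pos_iff.2 h.ne_zero
  have hβ0 := norm_pos_iff.2 h.ne_zero'
  set ρ := ‖β‖⁻¹ * ((p : ℝ)⁻¹) ^ (i + 1) with hρ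
  have hρj : ρ = ‖α‖ * (p : ℝ) ^ j := by
    have hK := h.norm_mul_norm
    have e : ((p : ℝ)⁻¹) ^ K = ((p : ℝ)⁻¹) ^ (i + 1) * ((p : ℝ)⁻¹) ^ j := by
      rw [← pow_add]; congr 1; omega
    rw [e] at hK
    rw [hρ, inv_mul_eq_div, div_eq_iff hβ0.ne', mul_right_comm, hK, mul_assoc, ← mul_pow,
      inv_mul_cancel₀ hp.ne', one_pow, mul_one]
  have hρ0 : 0 ≤ ρ := by positivity
  have hρ1 : ρ < 1 := by
    have h1 : (p : ℝ) ^ j < ‖α‖⁻¹ := by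
      rw [h.norm_inv, ← Real.rpow_natCast]
      exact Real.rpow_lt_rpow_of_exponent_lt hp1 hj
    rw [hρj]
    calc ‖α‖ * (p : ℝ) ^ j < ‖α‖ * ‖α‖⁻¹ := by gcongr
      _ = 1 := mul_inv_cancel₀ hα0.ne'
  have hlam : ‖α * (p : L) / β‖ * ((p : ℝ)⁻¹) ^ i = ‖α‖ * ρ := by
    rw [hρ, norm_div, norm_mul, norm_natCast_p, pow_succ]; ring
  have hαr : ‖α‖ = (p : ℝ) ^ (-r) := by
    rw [Real.rpow_neg hp.le, ← h.norm_inv, inv_inv]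
  refine ⟨mahlerBdd_specInt h.pos.le h.lt.le (by omega) ?_ a, fun δ hδ => ?_⟩
  · rw [hlam, ← hαr]
    exact mul_le_of_le_one_right hα0.le hρ1.le
  · set A := 1 + ‖(1 - (α * (p : L) / β)⁻¹) / (1 - α / β)‖ * (1 + ‖α / β‖) with hA
    have hA0 : 0 ≤ A := by positivity
    have ht : Tendsto (fun N : ℕ => A * ρ ^ N) atTop (𝓝 0) := by
      simpa using (tendsto_pow_atTop_nhds_zero_of_lt_one hρ0 hρ1).const_mul A
    obtain ⟨N₀, hN₀⟩ := eventually_atTop.1 (ht.eventually (ge_mem_nhds hδ))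
    refine ⟨N₀, fun N hN S w w' hw hw' hs hb hb' => ?_⟩
    have h1 := norm_pair_specInt_le (i := i) (by omega) h.ne_zero h.ne_zero' h.ne
      (mul_le_one₀ h.norm_lt_one.le hρ0 hρ1.le) hw hw' hs hb hb' a
    refine h1.trans ?_
    rw [← hA, mul_comm S, ← mul_assoc]
    exact mul_le_mul_of_nonneg_right (hN₀ N hN) hb.nonneg

end Negl

lemma valuation_eq_of_norm_eq {x y : ℚ_[p]} (hx : x ≠ 0) (hy : y ≠ 0) (h : ‖x‖ = ‖y‖) :
    x.valuation = y.valuation := by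
  rw [Padic.norm_eq_zpow_neg_valuation hx, Padic.norm_eq_zpow_neg_valuation hy] at h
  have := zpow_right_injective₀ (prime_cast_pos p) (one_lt_prime_cast p).ne' h
  simpa using this

lemma specFun_mul_of_mul {k : ℕ} {α β : L} (hlam : α * (p : L) / β ≠ 0) (a : ℤ_[p]) (j : ℕ) :
    (fun z : ℤ_[p] => specFun p L k α β ((p : ℚ_[p]) * a) j ((p : ℚ_[p]) * z)) =
      (α * (p : L) / β * (p : L) ^ (k - 2 - j)) •
        specInt L (α * (p : L) / β) a (k - 2 - j) := by
  have hp : (p : ℚ_[p]) ≠ 0 := by exact_mod_cast (Fact.out : p.Prime).ne_zero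
  ext z
  by_cases hz : z = a
  · simp [specFun, specInt, hz]
  have hne : (p : ℚ_[p]) * z ≠ p * a := fun h => hz (PadicInt.ext (mul_left_cancel₀ hp h))
  have hza : z - a ≠ 0 := sub_ne_zero.2 hz
  have hza' : ((z - a : ℤ_[p]) : ℚ_[p]) ≠ 0 := by
    intro h; exact hza (PadicInt.ext h)
  simp only [specFun, specInt, if_neg hne, if_neg hz, Pi.smul_apply, smul_eq_mul]
  rw [← mul_sub, ← PadicInt.coe_sub, Padic.valuation_mul hp hza', Padic.valuation_p,
    PadicInt.valuation_coe, zpow_add₀ hlam, zpow_one, zpow_natCast]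
  simp only [iotaL, map_mul, map_natCast, mul_pow]
  ring

lemma specFun_mul_of_not_mul {k : ℕ} {α β : L} {a : ℚ_[p]}
    (ha : ¬ ∃ z : ℤ_[p], a = (p : ℚ_[p]) * z) (j : ℕ) :
    (fun z : ℤ_[p] => specFun p L k α β a j ((p : ℚ_[p]) * z)) =
      ((α * (p : L) / β) ^ a.valuation * (p : L) ^ (k - 2 - j)) •
        fun z : ℤ_[p] => iotaL p L ((z : ℚ_[p]) - a / p) ^ (k - 2 - j) := by
  have hp : (p : ℚ_[p]) ≠ 0 := by exact_mod_cast (Fact.out : p.Prime).ne_zero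
  ext z
  have ha0 : a ≠ 0 := by
    rintro rfl
    exact ha ⟨0, by simp⟩
  have hap : 1 < ‖a / p‖ := by
    by_contra hle
    exact ha ⟨⟨a / p, not_lt.1 hle⟩, by rw [mul_div_cancel₀ _ hp]⟩
  have hne : (p : ℚ_[p]) * z ≠ a := fun h => ha ⟨z, h.symm⟩
  have hlt : ‖(p : ℚ_[p]) * z‖ < ‖a‖ := by
    rw [norm_div, lt_div_iff₀ (norm_pos_iff.2 hp), one_mul] at hap
    rw [norm_mul]
    exact (mul_le_of_le_one_right (norm_nonneg _) (PadicInt.norm_le_one z)).trans_lt hap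
  have hnorm : ‖(p : ℚ_[p]) * z - a‖ = ‖a‖ := by
    rw [sub_eq_add_neg, Padic.add_eq_max_of_ne (by rw [norm_neg]; exact hlt.ne), norm_neg,
      max_eq_right hlt.le]
  simp only [specFun, if_neg hne, Pi.smul_apply, smul_eq_mul]
  rw [valuation_eq_of_norm_eq (sub_ne_zero.2 hne) ha0 hnorm, mul_assoc]
  congr 1
  have e : (p : ℚ_[p]) * z - a = p * (z - a / p) := by rw [mul_sub, mul_div_cancel₀ _ hp]
  rw [e]
  simp only [iotaL, map_mul, map_natCast, mul_pow]

lemma negl_of_mem_span {k : ℕ} {r : ℝ} {α β : L} (hr : valL p L α = r)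
    (h : Data p (k - 1) r α β) {g : ℚ_[p] → L} (hg : g ∈ Submodule.span L (lGen p L k α β)) :
    Negl p (k - 1) r α β (fun z : ℤ_[p] => g ((p : ℚ_[p]) * z)) := by
  have hp : (p : ℚ_[p]) ≠ 0 := by exact_mod_cast (Fact.out : p.Prime).ne_zero
  have hpL : (p : L) ≠ 0 := by
    rw [← norm_ne_zero_iff, norm_natCast_p]; exact inv_ne_zero (prime_cast_pos p).ne'
  have hjlt : ∀ j : ℕ, (j : ℝ) < r → j < k - 1 := fun j hj => by
    exact_mod_cast hj.trans h.lt
  induction hg using Submodule.span_induction with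
  | mem x hx =>
    obtain ⟨j, hj, rfl | ⟨a, rfl⟩⟩ := hx
    · rw [hr] at hj
      have h1 := (Negl.sub_pow (r := r) (α := α) (β := β) (0 : ℚ_[p]) (hjlt j hj)).smul
        ((p : L) ^ j)
      convert h1 using 1
      ext z
      simp [monomialFun, iotaL, mul_pow]
    · rw [hr] at hj
      have hj' := hjlt j hj
      by_cases ha : ∃ z : ℤ_[p], a = (p : ℚ_[p]) * z
      · obtain ⟨z, rfl⟩ := ha
        rw [specFun_mul_of_mul (div_ne_zero (mul_ne_zero h.ne_zero hpL) h.ne_zero')]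
        exact (Negl.specInt h (by omega) hj z).smul _
      · rw [specFun_mul_of_not_mul ha]
        exact (Negl.sub_pow _ (by omega)).smul _
  | zero => exact Negl.zero
  | add x y _ _ hx hy => exact hx.add hy
  | smul c x _ hx => exact hx.smul c

lemma exists_negl_approx [FiniteDimensional ℚ_[p] L] {k : ℕ} {r : ℝ} {α β : L}
    (hr : valL p L α = r) (h : Data p (k - 1) r α β)
    (hall : ∀ f : ℚ_[p] → L, MemB p L k α β f → MemLalpha p L k α β f) (d m : ℕ) {ε : ℝ}
    (hε : 0 < ε) : ∃ g : ℤ_[p] → L, Negl p (k - 1) r α β g ∧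
      ∀ n : ℕ, ((n : ℝ) + 1) ^ r * ‖mahlerCoeff p L (testFun p L (k - 1) d m - g) n‖ ≤ ε := by
  have hcr := isCr_testFun (p := p) (L := L) h.pos.le h.lt.le d m
  rw [← hr] at hcr
  obtain ⟨-, happ⟩ := hall _ (memB_extendZero hcr)
  obtain ⟨g, hg, hlt⟩ := happ ε hε
  have hneg := negl_of_mem_span hr h hg
  refine ⟨_, hneg, ?_⟩
  have hlt' := (le_max_left _ _).trans_lt hlt
  have e : (fun z : ℤ_[p] => (extendZero (testFun p L (k - 1) d m) - g) ((p : ℚ_[p]) * z)) =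
      testFun p L (k - 1) d m - fun z : ℤ_[p] => g ((p : ℚ_[p]) * z) := by
    ext z; simp [extendZero_mul]
  rw [e, hr] at hlt'
  have hbdd : MahlerBdd p r (testFun p L (k - 1) d m - fun z : ℤ_[p] => g ((p : ℚ_[p]) * z)) := by
    have := (mahlerBdd_testFun (p := p) (L := L) h.pos.le h.lt.le d m).add (hneg.1.smul (-1))
    convert this using 1
    ext z; simp [sub_eq_add_neg]
  obtain ⟨B, hB⟩ := hbdd
  intro n
  refine le_trans ?_ hlt'.le
  exact le_ciSup (f := fun n : ℕ => ((n : ℝ) + 1) ^ r * ‖mahlerCoeff p L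
    (testFun p L (k - 1) d m - fun z : ℤ_[p] => g ((p : ℚ_[p]) * z)) n‖)
    ⟨B, by rintro _ ⟨n, rfl⟩; exact hB n⟩ n

lemma exists_coeffBound_congr {K e : ℕ} {x : L} (hx : x ≠ 0) {S : ℝ} {f : L[X]}
    (h : ModBound p K e S (C x * f)) :
    ∃ f' : L[X], Ypol p L e ^ K ∣ f - f' ∧ CoeffBound S (C x * f') := by
  obtain ⟨R, hR, hd⟩ := h
  have hC : C x * C x⁻¹ = (1 : L[X]) := by rw [← C_mul, mul_inv_cancel₀ hx, C_1]
  refine ⟨C x⁻¹ * R, ?_, ?_⟩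
  · have : f - C x⁻¹ * R = C x⁻¹ * (C x * f - R) := by
      linear_combination (-f) * hC
    rw [this]
    exact dvd_mul_of_dvd_right hd _
  · rwa [← mul_assoc, hC, one_mul]

lemma Sol.congr {K n : ℕ} {α β : L} {f g f' g' : L[X]} (h : Sol p K α β n f g)
    (hf : Ypol p L n ^ K ∣ f - f') (hg : Ypol p L n ^ K ∣ g - g') : Sol p K α β n f' g' := by
  intro e he
  have hd : Phi p L e ^ K ∣ Ypol p L n ^ K := pow_dvd_pow_of_dvd (Phi_dvd_Ypol he) K
  have e1 : C (α ^ (e + 1)) * f' - C (β ^ (e + 1)) * g' =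
      (C (α ^ (e + 1)) * f - C (β ^ (e + 1)) * g) - C (α ^ (e + 1)) * (f - f') +
        C (β ^ (e + 1)) * (g - g') := by ring
  rw [e1]
  exact dvd_add (dvd_sub (h e he) (dvd_mul_of_dvd_right (hd.trans hf) _))
    (dvd_mul_of_dvd_right (hd.trans hg) _)

lemma Sol.mul {K n : ℕ} {α β : L} {f g : L[X]} (h : Sol p K α β n f g) (q : L[X]) :
    Sol p K α β n (q * f) (q * g) := by
  intro e he
  have e1 : C (α ^ (e + 1)) * (q * f) - C (β ^ (e + 1)) * (q * g) =
      q * (C (α ^ (e + 1)) * f - C (β ^ (e + 1)) * g) := by ring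
  rw [e1]
  exact dvd_mul_of_dvd_right (h e he) _

lemma X_sub_one_pow_bound (K : ℕ) : CoeffBound 1 ((X - 1 : L[X]) ^ K) := by
  have hone : CoeffBound 1 (X - 1 : L[X]) := by
    simpa using CoeffBound.X_pow_sub_one (L := L) 1
  exact hone.pow_of_one K

lemma modBound_zero_of_modBound {K d : ℕ} {α : L} (hα : α ≠ 0) (hα1 : ‖α‖ ≤ 1) {S τ : ℝ}
    (hτ : τ ≤ 1) (hS : 0 ≤ S) {f : L[X]} (hf : ModBound p K d S (C (α ^ d) * f))
    (hw : ModBound p K d (τ * S) ((X - 1) ^ K * f)) :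
    ModBound p K 0 (max τ ((‖α‖⁻¹) ^ d * (K * ((p : ℝ)⁻¹) ^ d) ^ K) * S) f := by
  obtain ⟨R, hR, t₁, ht₁⟩ := hw
  obtain ⟨F, hF, t, ht⟩ := hf
  have hYE : Ypol p L d ^ K = (X - 1) ^ K * Epol p L d ^ K := by
    rw [← Epol_mul, mul_pow, mul_comm]
  have hmon : (X - 1 : L[X]).Monic := by simpa using monic_X_sub_C (1 : L)
  have hX : ((X - 1 : L[X]) ^ K) ≠ 0 := (hmon.pow K).ne_zero
  have hR' : (X - 1) ^ K * (f - Epol p L d ^ K * t₁) = R := by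
    rw [hYE] at ht₁
    linear_combination ht₁
  set R' := f - Epol p L d ^ K * t₁ with hR'def
  have hR'b : CoeffBound (τ * S) R' :=
    CoeffBound.of_monic_mul (hmon.pow K) (X_sub_one_pow_bound K) (by rwa [hR'])
  have hαd : ‖α ^ d‖ ≤ 1 := by rw [norm_pow]; exact pow_le_one₀ (norm_nonneg _) hα1
  set h := C (α ^ d) * t₁ - (X - 1) ^ K * t with hh
  have hFh : Epol p L d ^ K * h = F - C (α ^ d) * R' := by
    rw [hh, hR'def]
    rw [hYE] at ht
    linear_combination ht
  have hhb : CoeffBound S h := by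
    refine CoeffBound.of_monic_mul ((Epol_monic (p := p) d).pow K)
      ((Epol_bound (p := p) (L := L) d).pow_of_one K) ?_
    rw [hFh]
    refine hF.sub ((hR'b.C_mul _).mono ?_)
    have : τ * S ≤ S := mul_le_of_le_one_left hS hτ
    exact (mul_le_of_le_one_left hR'b.nonneg hαd).trans this
  have hC : C ((α ^ d)⁻¹) * C (α ^ d) = (1 : L[X]) := by
    rw [← C_mul, inv_mul_cancel₀ (pow_ne_zero d hα), C_1]
  have hE := ((Epol_modBound_zero (p := p) (L := L) K d).pow K).mul (hhb.modBound K 0)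
  have hsum := ((hR'b.modBound K 0).mono (mul_le_mul_of_nonneg_right (le_max_left τ
    ((‖α‖⁻¹) ^ d * (K * ((p : ℝ)⁻¹) ^ d) ^ K)) hS)).add ((hE.C_mul ((α ^ d)⁻¹)).mono (by
      rw [norm_inv, norm_pow, ← inv_pow, ← mul_assoc]
      exact mul_le_mul_of_nonneg_right (le_max_right τ _) hS))
  refine hsum.congr ((pow_dvd_pow_of_dvd (Ypol_dvd (Nat.zero_le d)) K).trans ?_)
  refine ⟨C ((α ^ d)⁻¹) * t, ?_⟩
  rw [hFh]
  linear_combination (-f + R') * hC + C ((α ^ d)⁻¹) * ht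

/-- If every element of `B(α)` lay in `L(α)`, the first component of a solution of large level
would be small at level `0`. -/
lemma exists_level_modBound_zero [FiniteDimensional ℚ_[p] L] {k : ℕ} {r : ℝ} {α β : L}
    (hr : valL p L α = r) (h : Data p (k - 1) r α β)
    (hall : ∀ f : ℚ_[p] → L, MemB p L k α β f → MemLalpha p L k α β f) {c : ℝ} (hc : 0 < c) :
    ∃ N : ℕ, ∀ (S : ℝ) (f g : L[X]), Sol p (k - 1) α β N f g →
      (∀ e ≤ N, ModBound p (k - 1) e S (C (α ^ e) * f)) →
      ModBound p (k - 1) N S (C (β ^ N) * g) → ModBound p (k - 1) 0 (c * S) f := by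
  set K := k - 1 with hK
  have hp := prime_cast_pos p
  have hα0 := norm_pos_iff.2 h.ne_zero
  have hβ0 := norm_pos_iff.2 h.ne_zero'
  have ht : Tendsto (fun d : ℕ => (K : ℝ) ^ K * ‖β‖ ^ d) atTop (𝓝 0) := by
    simpa using (tendsto_pow_atTop_nhds_zero_of_lt_one hβ0.le h.norm_lt_one').const_mul
      ((K : ℝ) ^ K)
  obtain ⟨d, hd⟩ := (ht.eventually (ge_mem_nhds hc)).exists
  have hdK : (‖α‖⁻¹) ^ d * (K * ((p : ℝ)⁻¹) ^ d) ^ K ≤ c := by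
    refine le_trans (le_of_eq ?_) hd
    have h1 : ‖β‖ = ‖α‖⁻¹ * ((p : ℝ)⁻¹) ^ K := by
      rw [← h.norm_mul_norm, inv_mul_cancel_left₀ hα0.ne']
    rw [h1, mul_pow, mul_pow, ← pow_mul, ← pow_mul, mul_comm d K]; ring
  have hpr : 0 < (p : ℝ) ^ r := by positivity
  set τ : ℝ := min c 1 with hτ
  have hτ0 : 0 < τ := lt_min hc one_pos
  choose g hgneg hgapp using fun m : ℕ => exists_negl_approx hr h hall d m
    (ε := τ / (p : ℝ) ^ r) (by positivity)
  choose N₀ hN₀ using fun m : ℕ => (hgneg m).2 τ hτ0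
  set D := (Ypol p L d ^ K).natDegree with hD
  set N := max d ((Finset.range D).sup N₀) with hN
  refine ⟨N, fun S f f₂ hsol hmod hmod₂ => ?_⟩
  have hS := hmod₂.nonneg
  have hdN : d ≤ N := le_max_left _ _
  obtain ⟨f', hff', hf'⟩ := exists_coeffBound_congr (pow_ne_zero N h.ne_zero) (hmod N le_rfl)
  obtain ⟨g', hgg', hg'⟩ := exists_coeffBound_congr (pow_ne_zero N h.ne_zero') hmod₂
  have hY : ∀ e ≤ N, Ypol p L e ^ K ∣ f' - f := fun e he => by
    rw [← neg_sub, dvd_neg]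
    exact (pow_dvd_pow_of_dvd (Ypol_dvd he) K).trans hff'
  have hmod' : ∀ e ≤ N, ModBound p K e S (C (α ^ e) * f') := fun e he =>
    (hmod e he).congr (by rw [← mul_sub]; exact dvd_mul_of_dvd_right (hY e he) _)
  set w := (X - 1) ^ K * f' with hw
  have hXb := X_sub_one_pow_bound (L := L) K
  have hcomm : ∀ (x : L) (u : L[X]), C x * ((X - 1) ^ K * u) = (X - 1) ^ K * (C x * u) :=
    fun x u => by ring
  have hwb : CoeffBound S (C (α ^ N) * w) := by
    rw [hw, hcomm]; simpa using hXb.mul hf'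
  have hwb' : CoeffBound S (C (β ^ N) * ((X - 1) ^ K * g')) := by
    rw [hcomm]; simpa using hXb.mul hg'
  have hwmod : ∀ e ≤ N, ModBound p K e S (C (α ^ e) * w) := fun e he => by
    rw [hw, hcomm]
    simpa using (hXb.modBound K e).mul (hmod' e he)
  have hwd : ModBound p K d (τ * S) w := by
    refine ModBound.of_modByMonic fun m => ?_
    by_cases hm : m < D
    · rw [← pair_testFun]
      have e : (fun i : ℕ => testFun p L K d m i) =
          (fun i : ℕ => (testFun p L K d m - g m) i) + fun i : ℕ => g m i := by
        ext i; simp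
      rw [e, pair_add_left]
      refine (IsUltrametricDist.norm_add_le_max _ _).trans (max_le ?_ ?_)
      · refine (norm_pair_le_of_mahler h.pos h.lt.le h.ne_zero h.norm_inv hwmod hwb
          (hgapp m)).trans_eq ?_
        field_simp
      · exact hN₀ m N ((Finset.le_sup (Finset.mem_range.2 hm)).trans (le_max_right _ _)) S w _
          (dvd_mul_right _ _) (dvd_mul_right _ _) ((hsol.congr hff' hgg').mul _) hwb hwb'
    · rw [coeff_eq_zero_of_natDegree_lt, norm_zero]
      · positivity
      · by_cases h1 : Ypol p L d ^ K = 1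
        · exfalso
          have : (Ypol p L d ^ K).eval 1 = 0 := by
            have hK0 : K ≠ 0 := by
              rintro h0
              have := h.pos.trans h.lt
              simp [h0] at this
            rw [eval_pow, Ypol]; simp [hK0]
          rw [h1] at this
          simp at this
        · exact (natDegree_modByMonic_lt _ ((Ypol_monic d).pow K) h1).trans_le (not_lt.1 hm)
  have hfin := modBound_zero_of_modBound h.ne_zero h.norm_lt_one.le (min_le_right c 1) hS
    (hmod' d hdN) hwd
  refine (hfin.mono ?_).congr ?_
  · exact mul_le_mul_of_nonneg_right (max_le (min_le_left c 1) hdK) hS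
  · rw [← neg_sub, dvd_neg]; exact hY 0 (Nat.zero_le _)

/-- The polynomial whose `n`-th coefficient is the coefficient of index `n * q + b` of `f`. -/
def comp (q b : ℕ) (f : L[X]) : L[X] :=
  ∑ n ∈ Finset.range (f.natDegree + 1), monomial n (f.coeff (n * q + b))

lemma coeff_comp {q : ℕ} (hq : 0 < q) (b : ℕ) (f : L[X]) (n : ℕ) :
    (comp q b f).coeff n = f.coeff (n * q + b) := by
  simp only [comp, finsetSum_coeff, coeff_monomial, Finset.sum_ite_eq', Finset.mem_range]
  split_ifs with h
  · rfl
  · rw [coeff_eq_zero_of_natDegree_lt]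
    have : n ≤ n * q := Nat.le_mul_of_pos_right n hq
    omega

lemma comp_sub {q : ℕ} (hq : 0 < q) (b : ℕ) (f g : L[X]) :
    comp q b (f - g) = comp q b f - comp q b g := by
  ext n; simp [coeff_comp hq]

lemma comp_add {q : ℕ} (hq : 0 < q) (b : ℕ) (f g : L[X]) :
    comp q b (f + g) = comp q b f + comp q b g := by
  ext n; simp [coeff_comp hq]

lemma comp_C_mul {q : ℕ} (hq : 0 < q) (b : ℕ) (x : L) (f : L[X]) :
    comp q b (C x * f) = C x * comp q b f := by
  ext n; simp [coeff_comp hq]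

lemma comp_expand_mul {q b : ℕ} (hb : b < q) (P w : L[X]) :
    comp q b (expand L q P * w) = P * comp q b w := by
  have hq : 0 < q := by omega
  induction P using Polynomial.induction_on' with
  | add P Q hP hQ => rw [map_add, add_mul, comp_add hq, hP, hQ, add_mul]
  | monomial m c =>
    ext n
    rw [expand_monomial, coeff_comp hq, ← C_mul_X_pow_eq_monomial, ← C_mul_X_pow_eq_monomial,
      mul_assoc, mul_assoc, coeff_C_mul, coeff_C_mul, coeff_X_pow_mul', coeff_X_pow_mul']
    by_cases hmn : m ≤ n
    · have h1 : m * q ≤ n * q := Nat.mul_le_mul_right q hmn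
      rw [if_pos (by omega), if_pos hmn, coeff_comp hq, Nat.sub_mul]
      congr 2
      omega
    · have h1 : (n + 1) * q ≤ m * q := Nat.mul_le_mul_right q (by omega)
      rw [add_mul, one_mul] at h1
      rw [if_neg (by omega), if_neg hmn]

lemma sum_X_pow_mul_expand_comp {q : ℕ} (hq : 0 < q) (f : L[X]) :
    ∑ b ∈ Finset.range q, X ^ b * expand L q (comp q b f) = f := by
  ext n
  rw [finsetSum_coeff, Finset.sum_eq_single (n % q)]
  · have h := Nat.div_add_mod n q
    have hsub : n - n % q = n / q * q := by rw [mul_comm]; omega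
    rw [coeff_X_pow_mul', if_pos (Nat.mod_le n q), hsub, coeff_expand_mul hq, coeff_comp hq]
    congr 1
    rw [mul_comm]; exact h
  · intro b hb hne
    rw [coeff_X_pow_mul']
    split_ifs with hbn
    · rw [coeff_expand hq, if_neg]
      intro hd
      apply hne
      rw [← Nat.mod_eq_of_lt (Finset.mem_range.1 hb)]
      exact ((Nat.modEq_iff_dvd' hbn).2 hd)
    · rfl
  · intro h
    exact absurd (Finset.mem_range.2 (Nat.mod_lt n hq)) h

lemma ModBound.comp {K e d b : ℕ} {S : ℝ} {f : L[X]} (h : ModBound p K (e + d) S f)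
    (hb : b < p ^ d) : ModBound p K e S (comp (p ^ d) b f) := by
  have hq : 0 < p ^ d := by omega
  obtain ⟨R, hR, t, ht⟩ := h
  refine ⟨Paper.comp (p ^ d) b R, fun n => by rw [coeff_comp hq]; exact hR _,
    Paper.comp (p ^ d) b t, ?_⟩
  rw [← comp_sub hq, ht, ← expand_Ypol, ← map_pow, comp_expand_mul hb]

lemma ModBound.of_comp {K e d : ℕ} {S : ℝ} (hS : 0 ≤ S) {f : L[X]}
    (h : ∀ b < p ^ d, ModBound p K e S (Paper.comp (p ^ d) b f)) :
    ModBound p K (e + d) S f := by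
  have hq : 0 < p ^ d := pow_pos (Fact.out : p.Prime).pos d
  rw [← sum_X_pow_mul_expand_comp hq f]
  refine ModBound.sum hS _ _ fun b hb => ?_
  obtain ⟨R, hR, t, ht⟩ := h b (Finset.mem_range.1 hb)
  have h1 : ModBound p K (e + d) S (expand L (p ^ d) (Paper.comp (p ^ d) b f)) := by
    refine ⟨expand L (p ^ d) R, hR.expand _, expand L (p ^ d) t, ?_⟩
    rw [← map_sub, ht, map_mul, map_pow, expand_Ypol]
  simpa using ((CoeffBound.X_pow b).modBound K (e + d)).mul h1

lemma Sol.comp {K N d b : ℕ} {α β : L} {f g : L[X]} (h : Sol p K α β (N + d) f g)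
    (hb : b < p ^ d) : Sol p K α β N (C (α ^ d) * Paper.comp (p ^ d) b f)
      (C (β ^ d) * Paper.comp (p ^ d) b g) := by
  have hq : 0 < p ^ d := by omega
  intro e he
  obtain ⟨t, ht⟩ := h (e + d) (by omega)
  refine ⟨Paper.comp (p ^ d) b t, ?_⟩
  rw [← comp_expand_mul hb (Phi p L e ^ K) t, map_pow (expand L (p ^ d)), expand_Phi, ← ht,
    comp_sub hq,
    comp_C_mul hq, comp_C_mul hq]
  simp only [← mul_assoc, ← C_mul, ← pow_add]
  rw [show e + 1 + d = e + d + 1 by ring]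

lemma ModBound.C_pow_comp {K e d b : ℕ} {S : ℝ} {x : L} {f : L[X]}
    (h : ModBound p K (e + d) S (C (x ^ (e + d)) * f)) (hb : b < p ^ d) :
    ModBound p K e S (C (x ^ e) * (C (x ^ d) * Paper.comp (p ^ d) b f)) := by
  have := h.comp hb
  rwa [comp_C_mul (by omega), pow_add, Polynomial.C_mul, mul_assoc] at this

lemma ModBound.of_C_pow_comp {K d : ℕ} {S : ℝ} (hS : 0 ≤ S) {x : L} {f : L[X]}
    (h : ∀ b < p ^ d, ModBound p K 0 S (C x * Paper.comp (p ^ d) b f)) :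
    ModBound p K d S (C x * f) := by
  rw [← zero_add d]
  refine ModBound.of_comp hS fun b hb => ?_
  rw [comp_C_mul (by omega)]
  exact h b hb

/-- If the first component of a solution is small at all positive levels, then the second
component is small at level `0`. -/
lemma exists_level_modBound_zero_right {K : ℕ} {r : ℝ} {α β : L} (h : Data p K r α β) {c : ℝ}
    (hc : 0 < c) : ∃ (M : ℕ) (η : ℝ), 0 < η ∧ ∀ (S : ℝ) (f g : L[X]), Sol p K α β M f g →
      (∀ e ≤ M, e ≠ 0 → ModBound p K e (η * S) (C (α ^ e) * f)) →
      ModBound p K M S (C (β ^ M) * g) → ModBound p K 0 (c * S) g := by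
  have hp := prime_cast_pos p
  have hα0 := norm_pos_iff.2 h.ne_zero
  have hβ0 := norm_pos_iff.2 h.ne_zero'
  have ht : Tendsto (fun d : ℕ => (K : ℝ) ^ K * ‖α‖ ^ d) atTop (𝓝 0) := by
    simpa using (tendsto_pow_atTop_nhds_zero_of_lt_one hα0.le h.norm_lt_one).const_mul
      ((K : ℝ) ^ K)
  obtain ⟨M, hM, hM0⟩ := ((ht.eventually (ge_mem_nhds hc)).and (eventually_ne_atTop 0)).exists
  have hMK : (‖β‖⁻¹) ^ M * (K * ((p : ℝ)⁻¹) ^ M) ^ K ≤ c := by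
    refine le_trans (le_of_eq ?_) hM
    have h1 : ‖α‖ = ‖β‖⁻¹ * ((p : ℝ)⁻¹) ^ K := by
      rw [← h.norm_mul_norm, mul_comm ‖α‖, inv_mul_cancel_left₀ hβ0.ne']
    rw [h1, mul_pow, mul_pow, ← pow_mul, ← pow_mul, mul_comm M K]; ring
  obtain ⟨π, hπ1, hπ⟩ := exists_partition_of_one (p := p) (L := L) K hM0
  choose κ hκ0 hκ using fun e => exists_coeffBound (π e)
  set κs : ℝ := ∑ e ∈ Finset.range M, κ e with hκs
  have hκs0 : 0 < κs :=
    Finset.sum_pos (fun e _ => hκ0 e) (by simpa using hM0)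
  have hκe : ∀ e < M, κ e ≤ κs := fun e he =>
    Finset.single_le_sum (fun i _ => (hκ0 i).le) (Finset.mem_range.2 he)
  refine ⟨M, min 1 (c * ‖β‖ ^ M) / κs, by positivity, fun S f g hsol hf hg => ?_⟩
  set η := min 1 (c * ‖β‖ ^ M) / κs with hη
  have hηκ : κs * η = min 1 (c * ‖β‖ ^ M) := by rw [hη]; field_simp
  have hS := hg.nonneg
  obtain ⟨G, hG, hGd⟩ := hg
  have hF : ∀ e, ∃ F : L[X], e < M → CoeffBound (η * S) F ∧ Phi p L e ^ K ∣ G - F := by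
    intro e
    by_cases he : e < M
    · obtain ⟨F, hFb, hFd⟩ := hf (e + 1) (by omega) (by omega)
      refine ⟨C (β ^ (M - (e + 1))) * F, fun _ => ⟨(hFb.C_mul _).mono ?_, ?_⟩⟩
      · refine mul_le_of_le_one_left hFb.nonneg ?_
        rw [norm_pow]; exact pow_le_one₀ (norm_nonneg _) h.norm_lt_one'.le
      · have d1 := (pow_dvd_pow_of_dvd (Phi_dvd_Ypol (p := p) (L := L) he) K).trans hGd
        have d2 := (pow_dvd_pow_of_dvd
          (Phi_dvd_Ypol (p := p) (L := L) (Nat.lt_succ_self e)) K).trans hFd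
        have d3 := hsol e he
        have hβM : (C (β ^ M) : L[X]) = C (β ^ (M - (e + 1))) * C (β ^ (e + 1)) := by
          rw [← C_mul, ← pow_add]; congr 2; omega
        have e1 : G - C (β ^ (M - (e + 1))) * F =
            C (β ^ (M - (e + 1))) * (C (α ^ (e + 1)) * f - F) -
            C (β ^ (M - (e + 1))) * (C (α ^ (e + 1)) * f - C (β ^ (e + 1)) * g) -
            (C (β ^ M) * g - G) := by
          rw [hβM]; ring
        rw [e1]
        exact dvd_sub (dvd_sub (dvd_mul_of_dvd_right d2 _) (dvd_mul_of_dvd_right d3 _)) d1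
    · exact ⟨0, fun h => absurd h he⟩
  choose F hF using hF
  set b : L[X] := ∑ e ∈ Finset.range M, π e * F e with hb
  have hηS : 0 ≤ η * S := by positivity
  have hbb : CoeffBound (κs * η * S) b := by
    refine CoeffBound.sum (by positivity) _ _ fun e he => ?_
    have he := Finset.mem_range.1 he
    refine ((hκ e).mul (hF e he).1).mono ?_
    rw [mul_assoc]
    exact mul_le_mul_of_nonneg_right (hκe e he) hηS
  have hdiv : Epol p L M ^ K ∣ G - b := by
    refine Epol_pow_dvd K M fun e he => ?_
    have e1 : G - b = (G - F e) - ∑ i ∈ Finset.range M, π i * (F i - F e) := by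
      simp only [mul_sub, Finset.sum_sub_distrib, ← Finset.sum_mul, hπ1, hb]
      ring
    rw [e1]
    refine dvd_sub (hF e he).2 (Finset.dvd_sum fun i hi => ?_)
    by_cases hie : i = e
    · simp [hie]
    · exact dvd_mul_of_dvd_left (hπ i (Finset.mem_range.1 hi) e he (Ne.symm hie)) _
  obtain ⟨t, ht⟩ := hdiv
  have htb : CoeffBound S t := by
    refine CoeffBound.of_monic_mul ((Epol_monic (p := p) M).pow K)
      ((Epol_bound (p := p) (L := L) M).pow_of_one K) ?_
    rw [← ht]
    refine hG.sub (hbb.mono ?_)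
    rw [hηκ]
    exact mul_le_of_le_one_left hS (min_le_left _ _)
  have hE := ((Epol_modBound_zero (p := p) (L := L) K M).pow K).mul (htb.modBound K 0)
  have hC : C ((β ^ M)⁻¹) * C (β ^ M) = (1 : L[X]) := by
    rw [← C_mul, inv_mul_cancel₀ (pow_ne_zero M h.ne_zero'), C_1]
  have hsum : ModBound p K 0 (c * S)
      (C ((β ^ M)⁻¹) * b + C ((β ^ M)⁻¹) * (Epol p L M ^ K * t)) := by
    refine (((hbb.C_mul _).modBound K 0).mono ?_).add ((hE.C_mul _).mono ?_)
    · rw [hηκ, norm_inv, norm_pow, ← mul_assoc]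
      refine mul_le_mul_of_nonneg_right ?_ hS
      rw [inv_mul_le_iff₀ (by positivity), mul_comm]
      exact min_le_right _ _
    · rw [norm_inv, norm_pow, ← inv_pow, ← mul_assoc]
      exact mul_le_mul_of_nonneg_right hMK hS
  refine hsum.congr ((pow_dvd_pow_of_dvd (Ypol_dvd (Nat.zero_le M)) K).trans ?_)
  have e1 : g - (C ((β ^ M)⁻¹) * b + C ((β ^ M)⁻¹) * (Epol p L M ^ K * t)) =
      C ((β ^ M)⁻¹) * (C (β ^ M) * g - G) := by
    rw [← ht]; linear_combination (-g) * hC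
  rw [e1]
  exact dvd_mul_of_dvd_right hGd _

lemma Sol.mono {K m n : ℕ} {α β : L} {f g : L[X]} (h : Sol p K α β n f g) (hmn : m ≤ n) :
    Sol p K α β m f g := fun e he => h e (he.trans_le hmn)

variable (p) in
/-- Both components of `(f, g)`, scaled by `α ^ e` and `β ^ e`, are bounded by `S` at
level `e`. -/
def PairBound (K : ℕ) (α β : L) (f g : L[X]) (e : ℕ) (S : ℝ) : Prop :=
  ModBound p K e S (C (α ^ e) * f) ∧ ModBound p K e S (C (β ^ e) * g)

lemma PairBound.mono {K e : ℕ} {α β : L} {f g : L[X]} {S T : ℝ}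
    (h : PairBound p K α β f g e S) (hST : S ≤ T) : PairBound p K α β f g e T :=
  ⟨h.1.mono hST, h.2.mono hST⟩

lemma ModBound.of_succ {K e : ℕ} {x : L} (hx : x ≠ 0) {f : L[X]} {S : ℝ}
    (h : ModBound p K (e + 1) S (C (x ^ (e + 1)) * f)) :
    ModBound p K e (‖x‖⁻¹ * S) (C (x ^ e) * f) := by
  have h1 := (h.of_le e.le_succ).C_mul x⁻¹
  rwa [norm_inv, ← mul_assoc, ← Polynomial.C_mul, pow_succ', inv_mul_cancel_left₀ hx] at h1

lemma PairBound.of_succ {K e : ℕ} {α β : L} (hα : α ≠ 0) (hβ : β ≠ 0) {f g : L[X]} {S : ℝ}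
    (h : PairBound p K α β f g (e + 1) S) :
    PairBound p K α β f g e (max ‖α‖⁻¹ ‖β‖⁻¹ * S) := by
  have hS := h.1.nonneg
  exact ⟨(h.1.of_succ hα).mono (mul_le_mul_of_nonneg_right (le_max_left _ _) hS),
    (h.2.of_succ hβ).mono (mul_le_mul_of_nonneg_right (le_max_right _ _) hS)⟩

/-- If `L(α) = B(α)`, then bounds for a solution on a long enough window of levels improve at
the bottom of the window by an arbitrary factor. -/
lemma exists_window_pairBound [FiniteDimensional ℚ_[p] L] {k : ℕ} {r : ℝ} {α β : L}
    (hr : valL p L α = r) (h : Data p (k - 1) r α β)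
    (hall : ∀ f, MemB p L k α β f → MemLalpha p L k α β f) {c : ℝ} (hc : 0 < c) :
    ∃ N ≠ 0, ∀ (d : ℕ) (S : ℝ) (f g : L[X]), Sol p (k - 1) α β (N + d) f g →
      (∀ e ≤ N, PairBound p (k - 1) α β f g (e + d) S) →
      PairBound p (k - 1) α β f g d (c * S) := by
  obtain ⟨M, η, hη, hM⟩ := exists_level_modBound_zero_right h hc
  obtain ⟨A, hA⟩ := exists_level_modBound_zero hr h hall (lt_min hc hη)
  have hleft : ∀ (d : ℕ) (S : ℝ) (f g : L[X]), Sol p (k - 1) α β (A + d) f g →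
      (∀ e ≤ A, PairBound p (k - 1) α β f g (e + d) S) →
      ModBound p (k - 1) d (min c η * S) (C (α ^ d) * f) := by
    intro d S f g hs hb
    refine ModBound.of_C_pow_comp (mul_nonneg (lt_min hc hη).le (hb 0 (Nat.zero_le _)).1.nonneg)
      fun b hbd => ?_
    exact hA S _ _ (hs.comp hbd) (fun e he => (hb e he).1.C_pow_comp hbd)
      ((hb A le_rfl).2.C_pow_comp hbd)
  refine ⟨A + M + 1, by omega, fun d S f g hs hb => ?_⟩
  have hS : 0 ≤ S := (hb 0 (Nat.zero_le _)).1.nonneg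
  have hf : ∀ e ≤ M, ModBound p (k - 1) (e + d) (min c η * S) (C (α ^ (e + d)) * f) := by
    intro e he
    refine hleft (e + d) S f g (hs.mono (by omega)) fun i hi => ?_
    rw [← add_assoc]
    exact hb (i + e) (by omega)
  refine ⟨?_, ModBound.of_C_pow_comp (mul_nonneg hc.le hS) fun b hbd => ?_⟩
  · have h0 := hf 0 (Nat.zero_le _)
    rw [zero_add] at h0
    exact h0.mono (mul_le_mul_of_nonneg_right (min_le_left _ _) hS)
  · refine hM S _ _ ((hs.mono (by omega)).comp hbd) (fun e he _ => ?_)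
      ((hb M (by omega)).2.C_pow_comp hbd)
    exact ((hf e he).C_pow_comp hbd).mono (mul_le_mul_of_nonneg_right (min_le_right _ _) hS)

/-- If bounds improve by the factor `c / max ‖α‖⁻¹ ‖β‖⁻¹` on windows of length `N`, then the
bound of a solution of level `n` decays geometrically away from `n`. -/
lemma pairBound_of_window {K N n : ℕ} {α β : L} (hα : α ≠ 0) (hβ : β ≠ 0)
    (hC1 : 1 ≤ max ‖α‖⁻¹ ‖β‖⁻¹) {c : ℝ} (hc : 0 < c) (hc1 : c ≤ 1) (hN : N ≠ 0)
    {f g : L[X]}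
    (hwin : ∀ (d : ℕ) (S : ℝ), N + d ≤ n → (∀ e ≤ N, PairBound p K α β f g (e + d) S) →
      PairBound p K α β f g d (c / max ‖α‖⁻¹ ‖β‖⁻¹ * S))
    (hn : PairBound p K α β f g n 1) (j d : ℕ) (hj : d + j = n) :
    PairBound p K α β f g d (max ‖α‖⁻¹ ‖β‖⁻¹ ^ N * c ^ (j / N)) := by
  set C₀ := max ‖α‖⁻¹ ‖β‖⁻¹ with hC₀
  have hC0 : 0 < C₀ := by linarith
  have hshort : ∀ j d, d + j = n → PairBound p K α β f g d (C₀ ^ j) := by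
    intro j
    induction j with
    | zero => intro d hd; rw [add_zero] at hd; simpa [hd] using hn
    | succ j ih =>
      intro d hd
      rw [pow_succ']
      exact (ih (d + 1) (by omega)).of_succ hα hβ
  induction j using Nat.strong_induction_on generalizing d with
  | _ j ih =>
    rcases lt_or_ge j N with hjN | hjN
    · rw [Nat.div_eq_of_lt hjN, pow_zero, mul_one]
      exact (hshort j d hj).mono (pow_le_pow_right₀ hC1 hjN.le)
    · set s := C₀ ^ N * c ^ ((j - N) / N) with hs
      have hs0 : 0 ≤ s := by positivity
      have habove : ∀ e ≤ N, e ≠ 0 → PairBound p K α β f g (e + d) s := by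
        intro e he he0
        refine (ih (j - e) (by omega) (e + d) (by omega)).mono ?_
        refine mul_le_mul_of_nonneg_left ?_ (by positivity)
        exact pow_le_pow_of_le_one hc.le hc1 (Nat.div_le_div_right (by omega))
      have hall : ∀ e ≤ N, PairBound p K α β f g (e + d) (C₀ * s) := by
        intro e he
        rcases eq_or_ne e 0 with rfl | he0
        · have h1 := habove 1 (by omega) one_ne_zero
          rw [add_comm] at h1
          rw [zero_add]
          exact h1.of_succ hα hβ
        · exact (habove e he he0).mono (le_mul_of_one_le_left hs0 hC1)
      refine (hwin d _ (by omega) hall).mono (le_of_eq ?_)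
      have hdiv : j / N = (j - N) / N + 1 := Nat.div_eq_sub_div (by omega) hjN
      rw [hs, hdiv, pow_succ]
      field_simp

lemma not_forall_memLalpha [FiniteDimensional ℚ_[p] L] {k : ℕ} {r : ℝ} {α β : L}
    (hr : valL p L α = r) (h : Data p (k - 1) r α β) :
    ¬ ∀ f, MemB p L k α β f → MemLalpha p L k α β f := by
  intro hall
  have hK : k - 1 ≠ 0 := by
    intro h0
    have h1 := h.pos.trans h.lt
    simp [h0] at h1
  have hC1 : 1 ≤ max ‖α‖⁻¹ ‖β‖⁻¹ :=
    le_max_of_le_left ((one_le_inv₀ (norm_pos_iff.2 h.ne_zero)).2 h.norm_lt_one.le)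
  set C₀ := max ‖α‖⁻¹ ‖β‖⁻¹ with hC₀
  obtain ⟨N, hN, hwin⟩ := exists_window_pairBound hr h hall
    (c := 1 / 2 / C₀) (by positivity)
  have ht : Tendsto (fun m : ℕ => C₀ ^ N * (1 / 2 : ℝ) ^ m) atTop (𝓝 0) := by
    simpa using (tendsto_pow_atTop_nhds_zero_of_lt_one (r := (1 / 2 : ℝ)) (by norm_num)
      (by norm_num)).const_mul (C₀ ^ N)
  obtain ⟨m, hm, hm0⟩ :=
    ((ht.eventually (gt_mem_nhds one_pos)).and (eventually_ne_atTop 0)).exists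
  obtain ⟨f, g, hs, hf, hg, hfg⟩ := exists_sol (k - 1) h.ne_zero h.ne_zero' h.norm_lt_one.le
    h.norm_lt_one'.le h.norm_mul_norm (mul_ne_zero hm0 hN)
  have hb := pairBound_of_window (c := 1 / 2) h.ne_zero h.ne_zero' hC1 (by norm_num)
    (by norm_num) hN (fun d S hd hw => hwin d S f g (hs.mono hd) hw)
    ⟨hf.modBound (k - 1) _, hg.modBound (k - 1) _⟩ (m * N) 0 (zero_add _)
  rw [Nat.mul_div_cancel _ (Nat.pos_of_ne_zero hN)] at hb
  have h1 := hb.1.eval_one hK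
  have h2 := hb.2.eval_one hK
  rw [pow_zero, C_1, one_mul] at h1 h2
  rcases hfg with hfg | hfg <;> linarith

end

/-- The Banach space `Π(V) = B(α)/L(α)` is nonzero; equivalently, `L(α)` is a
proper closed subspace of `B(α)`. -/
theorem statement11 (p : ℕ) [Fact p.Prime] (L : Type) [NontriviallyNormedField L]
    [NormedAlgebra ℚ_[p] L] [FiniteDimensional ℚ_[p] L] [IsUltrametricDist L]
    (k : ℕ) (α β : L) (h : Hyps p L k α β) :
    ∃ f : ℚ_[p] → L, MemB p L k α β f ∧ ¬ MemLalpha p L k α β f := by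
  by_contra hcon
  exact not_forall_memLalpha rfl (hyps_data h) fun f hf => by_contra fun hn => hcon ⟨f, hf, hn⟩

end Paper

end
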